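/- arXiv:1810.00172 — 2 statements merged into one kernel-verified Lean document; each statement's English description precedes it below -/
import Mathlib

section
/- Let X be a Banach space, n ≥ 1, p ∈ (1,∞), and ω ∈ A_p(ℝ^n;R_n). Then the set of inverse Fourier transforms F⁻¹g of X-valued smooth compactly supported functions g ∈ C_c^∞(ℝ^n_*;X), where ℝ^n_* = (ℝ∖{0})^n, is dense in L^p_ω(ℝ^n;X). -/
open MeasureTheory Filter Set
open scoped ENNReal NNReal SchwartzMap FourierTransform

noncomputable section

/-- The sign `±1` attached to a boolean, used to model Rademacher variables. -/
def rsign (b : Bool) : ℝ := if b then 1 else -1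

section RBound

variable {X Y : Type*} [NormedAddCommGroup X] [NormedSpace ℂ X]
  [NormedAddCommGroup Y] [NormedSpace ℂ Y]

/-- `C` is an R-bound for the set `𝒯` of operators: for all finite choices
`T i ∈ 𝒯` and vectors `x i`, the Rademacher average (here written as a sum over all
sign patterns, the normalizing factors `2^{-k}` cancelling on both sides) satisfies
`‖∑ ε i • T i (x i)‖_{L²(Ω;Y)} ≤ C ‖∑ ε i • x i‖_{L²(Ω;X)}`. -/
def IsRBoundOf (𝒯 : Set (X →L[ℂ] Y)) (C : ℝ) : Prop :=
  0 ≤ C ∧ ∀ (k : ℕ) (T : Fin k → (X →L[ℂ] Y)) (x : Fin k → X), (∀ i, T i ∈ 𝒯) →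
    ∑ ε : Fin k → Bool, ‖∑ i, rsign (ε i) • (T i) (x i)‖ ^ 2
      ≤ C ^ 2 * ∑ ε : Fin k → Bool, ‖∑ i, rsign (ε i) • x i‖ ^ 2

/-- Pisier's property `(α)` with constant `C`. -/
def HasPisierAlphaWith (X : Type*) [NormedAddCommGroup X] [NormedSpace ℂ X] (C : ℝ) : Prop :=
  0 ≤ C ∧ ∀ (M N : ℕ) (a : Fin M → Fin N → ℂ) (x : Fin M → Fin N → X),
    (∀ i j, ‖a i j‖ ≤ 1) →
    ∑ ε : Fin M → Bool, ∑ δ : Fin N → Bool,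
        ‖∑ i, ∑ j, (rsign (ε i) * rsign (δ j)) • (a i j • x i j)‖ ^ 2
      ≤ C ^ 2 * ∑ ε : Fin M → Bool, ∑ δ : Fin N → Bool,
          ‖∑ i, ∑ j, (rsign (ε i) * rsign (δ j)) • x i j‖ ^ 2

/-- Pisier's property `(α)`. -/
def HasPisierAlpha (X : Type*) [NormedAddCommGroup X] [NormedSpace ℂ X] : Prop :=
  ∃ C, HasPisierAlphaWith X C

end RBound

section Hilbert

variable {X : Type*} [NormedAddCommGroup X] [NormedSpace ℝ X]

/-- Truncated Hilbert transform. -/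
def truncHilbert (f : ℝ → X) (ε : ℝ) (x : ℝ) : X :=
  ∫ t in {t : ℝ | ε ≤ |x - t|}, (x - t)⁻¹ • f t

/-- The Hilbert transform `(Hf)(x) = lim_{ε ↓ 0} ∫_{|x-t| ≥ ε} f(t)/(x-t) dt`. -/
def hilbertTransform (f : ℝ → X) (x : ℝ) : X := by
  haveI : Nonempty X := ⟨0⟩
  exact limUnder (nhdsWithin (0 : ℝ) (Ioi 0)) (fun ε => truncHilbert f ε x)

end Hilbert

/-- A complex Banach space is a UMD space iff it is of class HT: the Hilbert transform,
initially defined on `X`-valued Schwartz functions, induces a bounded operator on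
`L^p(ℝ; X)` for some `p ∈ (1, ∞)`. -/
def IsUMD (X : Type*) [NormedAddCommGroup X] [NormedSpace ℂ X] : Prop :=
  ∃ p : ℝ, 1 < p ∧ ∃ C : ℝ, 0 < C ∧ ∀ f : 𝓢(ℝ, X),
    ∫⁻ x : ℝ, (‖hilbertTransform (⇑f) x‖₊ : ℝ≥0∞) ^ p
      ≤ ENNReal.ofReal C ^ p * ∫⁻ x : ℝ, (‖f x‖₊ : ℝ≥0∞) ^ p

/-- `ℝ^n` as a Euclidean space. -/
abbrev Euc (n : ℕ) := EuclideanSpace ℝ (Fin n)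

section Mult

variable {n : ℕ} {X Y : Type*} [NormedAddCommGroup X] [NormedSpace ℂ X]
  [NormedAddCommGroup Y] [NormedSpace ℂ Y]

/-- The Fourier multiplier operator `T_m f = 𝓕⁻¹ (ξ ↦ m ξ (𝓕 f ξ))` with
operator-valued symbol `m`. -/
def fourierMult (m : Euc n → (X →L[ℂ] Y)) (f : Euc n → X) : Euc n → Y :=
  𝓕⁻ (fun ξ => m ξ (𝓕 f ξ))

/-- The Fourier multiplier operator on the real line with operator-valued symbol. -/
def fourierMult1 (m : ℝ → (X →L[ℂ] Y)) (f : ℝ → X) : ℝ → Y :=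
  𝓕⁻ (fun ξ => m ξ (𝓕 f ξ))

/-- The spectral projection `Δ[A]`, the Fourier multiplier with symbol `1_A`. -/
def sproj (A : Set (Euc n)) (f : Euc n → X) : Euc n → X :=
  𝓕⁻ (A.indicator (𝓕 f))

/-- The spectral projection `Δ[A]` on the real line. -/
def sproj1 (A : Set ℝ) (f : ℝ → X) : ℝ → X :=
  𝓕⁻ (A.indicator (𝓕 f))

end Mult

section Weights

variable {n : ℕ}

/-- A weight: measurable, positive and finite a.e., and locally integrable. -/
def IsWeight (w : Euc n → ℝ≥0∞) : Prop :=
  Measurable w ∧ (∀ᵐ x : Euc n, 0 < w x ∧ w x < ⊤) ∧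
    ∀ K : Set (Euc n), IsCompact K → ∫⁻ x in K, w x ≠ ⊤

/-- A weight on the real line. -/
def IsWeight1 (w : ℝ → ℝ≥0∞) : Prop :=
  Measurable w ∧ (∀ᵐ x : ℝ, 0 < w x ∧ w x < ⊤) ∧
    ∀ K : Set ℝ, IsCompact K → ∫⁻ x in K, w x ≠ ⊤

/-- The closed axis-parallel rectangle determined by `a` and `b`. -/
def rectOf (a b : Fin n → ℝ) : Set (Euc n) := {x : Euc n | ∀ i, x i ∈ Icc (a i) (b i)}

/-- The closed axis-parallel cube with corner `a` and side length `h`. -/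
def cubeOf (a : Fin n → ℝ) (h : ℝ) : Set (Euc n) := {x : Euc n | ∀ i, x i ∈ Icc (a i) (a i + h)}

/-- `(|A|⁻¹ ∫_A ω)(|A|⁻¹ ∫_A σ^{-1/(p-1)})^{p-1}`. -/
def apSetChar (p : ℝ) (A : Set (Euc n)) (ω σ : Euc n → ℝ≥0∞) : ℝ≥0∞ :=
  ((∫⁻ x in A, ω x) / volume A) *
    (((∫⁻ x in A, σ x ^ (-(p - 1)⁻¹)) / volume A) ^ (p - 1))

/-- The two-weight Muckenhoupt characteristic `[ω,σ]_{A_p(ℝ^n; 𝓡_n)}` over rectangles. -/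
def rectApChar (n : ℕ) (p : ℝ) (ω σ : Euc n → ℝ≥0∞) : ℝ≥0∞ :=
  ⨆ (a : Fin n → ℝ) (b : Fin n → ℝ) (_ : ∀ i, a i < b i), apSetChar p (rectOf a b) ω σ

/-- The two-weight Muckenhoupt characteristic `[ω,σ]_{A_p(ℝ^n; 𝓠_n)}` over cubes. -/
def cubeApChar (n : ℕ) (p : ℝ) (ω σ : Euc n → ℝ≥0∞) : ℝ≥0∞ :=
  ⨆ (a : Fin n → ℝ) (h : ℝ) (_ : 0 < h), apSetChar p (cubeOf a h) ω σ

/-- The two-weight Muckenhoupt characteristic `[ω,σ]_{A_p(ℝ)}` over bounded intervals. -/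
def intervalApChar (p : ℝ) (ω σ : ℝ → ℝ≥0∞) : ℝ≥0∞ :=
  ⨆ (a : ℝ) (b : ℝ) (_ : a < b),
    ((∫⁻ x in Icc a b, ω x) / volume (Icc a b)) *
      (((∫⁻ x in Icc a b, σ x ^ (-(p - 1)⁻¹)) / volume (Icc a b)) ^ (p - 1))

variable {X : Type*} [NormedAddCommGroup X]

/-- The weighted `L^p`-norm `(∫ ‖g‖^p ω)^{1/p}`. -/
def wnormp (p : ℝ) (w : Euc n → ℝ≥0∞) (g : Euc n → X) : ℝ≥0∞ :=
  (∫⁻ x, (‖g x‖₊ : ℝ≥0∞) ^ p * w x) ^ p⁻¹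

/-- The weighted `L^p`-norm on the real line. -/
def wnormp1 (p : ℝ) (w : ℝ → ℝ≥0∞) (g : ℝ → X) : ℝ≥0∞ :=
  (∫⁻ x : ℝ, (‖g x‖₊ : ℝ≥0∞) ^ p * w x) ^ p⁻¹

end Weights

section WRB

variable {n : ℕ} {X Y : Type*} [NormedAddCommGroup X] [NormedSpace ℂ X]
  [NormedAddCommGroup Y] [NormedSpace ℂ Y]

/-- R-boundedness (with bound `C`) of a family `ℱ` of operators, viewed as maps from functions
to functions, between the weighted spaces `L^p_σ(ℝ^n;X)` and `L^p_ω(ℝ^n;Y)`, tested on the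
dense class of Schwartz functions. -/
def IsWeightedRBoundOf (p : ℝ) (σ ω : Euc n → ℝ≥0∞)
    (ℱ : Set ((Euc n → X) → (Euc n → Y))) (C : ℝ≥0∞) : Prop :=
  ∀ (k : ℕ) (T : Fin k → ((Euc n → X) → (Euc n → Y))) (f : Fin k → 𝓢(Euc n, X)),
    (∀ i, T i ∈ ℱ) →
    ∑ ε : Fin k → Bool, (wnormp p ω (fun x => ∑ i, rsign (ε i) • T i (⇑(f i)) x)) ^ (2 : ℕ)
      ≤ C ^ (2 : ℕ) *
        ∑ ε : Fin k → Bool, (wnormp p σ (fun x => ∑ i, rsign (ε i) • (f i) x)) ^ (2 : ℕ)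

/-- One-dimensional version of `IsWeightedRBoundOf`. -/
def IsWeightedRBoundOf1 (p : ℝ) (σ ω : ℝ → ℝ≥0∞)
    (ℱ : Set ((ℝ → X) → (ℝ → Y))) (C : ℝ≥0∞) : Prop :=
  ∀ (k : ℕ) (T : Fin k → ((ℝ → X) → (ℝ → Y))) (f : Fin k → 𝓢(ℝ, X)),
    (∀ i, T i ∈ ℱ) →
    ∑ ε : Fin k → Bool, (wnormp1 p ω (fun x => ∑ i, rsign (ε i) • T i (⇑(f i)) x)) ^ (2 : ℕ)
      ≤ C ^ (2 : ℕ) *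
        ∑ ε : Fin k → Bool, (wnormp1 p σ (fun x => ∑ i, rsign (ε i) • (f i) x)) ^ (2 : ℕ)

end WRB

section PDeriv

variable {n : ℕ} {W : Type*} [NormedAddCommGroup W] [NormedSpace ℝ W]

/-- Partial derivative in the `i`-th coordinate direction. -/
def pderivCoord (i : Fin n) (f : Euc n → W) : Euc n → W :=
  fun x => fderiv ℝ f x (EuclideanSpace.single i (1 : ℝ))

/-- Iterated partial derivative `∂^α f` for a multi-index `α`. -/
def pderivMulti (α : Fin n → ℕ) (f : Euc n → W) : Euc n → W :=
  (List.finRange n).foldr (fun i g => (pderivCoord i)^[α i] g) f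

end PDeriv

/-- The (possibly reflected) interval `e • [a, b]`. -/
def signIcc (e : Bool) (a b : ℝ) : Set ℝ := if e then Icc a b else Icc (-b) (-a)

/-- The dyadic interval `η [2^k, 2^{k+1}]`. -/
def dyadicI (k : ℤ) (e : Bool) : Set ℝ := signIcc e ((2 : ℝ) ^ k) ((2 : ℝ) ^ (k + 1))

/-- The rectangle `E_{ln+r, η}` from the Littlewood–Paley blocking `𝓔_n`. -/
def Eblock (n : ℕ) (l : ℤ) (r : Fin n) (η : Fin n → Bool) : Set (Euc n) :=
  {x : Euc n | ∀ j : Fin n, x j ∈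
    (if j < r then signIcc (η j) 0 ((2 : ℝ) ^ (l + 1))
     else if j = r then signIcc (η j) ((2 : ℝ) ^ l) ((2 : ℝ) ^ (l + 1))
     else signIcc (η j) 0 ((2 : ℝ) ^ l))}

/-- The family `𝓔_n`. -/
def Efam (n : ℕ) : Set (Set (Euc n)) := {E | ∃ l r η, E = Eblock n l r η}

/-- A product of dyadic intervals, member of the family `𝓘_n`. -/
def Irect (n : ℕ) (k : Fin n → ℤ) (η : Fin n → Bool) : Set (Euc n) :=
  {x : Euc n | ∀ j, x j ∈ dyadicI (k j) (η j)}

/-- The family `𝓘_n` of products of dyadic intervals. -/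
def Ifam (n : ℕ) : Set (Set (Euc n)) := {I | ∃ k η, I = Irect n k η}

section Decomp

variable {E : Type*} [NormedAddCommGroup E] [NormedSpace ℂ E] {ι : Type*}

/-- A pre-decomposition: a family of bounded projections with `Δ_i Δ_j = 0` for `i ≠ j`. -/
def IsPreDecomp (Δ : ι → (E →L[ℂ] E)) : Prop :=
  (∀ i, ∀ x, Δ i (Δ i x) = Δ i x) ∧ ∀ i j, i ≠ j → ∀ x, Δ i (Δ j x) = 0

/-- An unconditional decomposition: a pre-decomposition with `x = ∑_i Δ_i x`
(unconditional, i.e. summable) for every `x`. -/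
def IsUncondDecomp (Δ : ι → (E →L[ℂ] E)) : Prop :=
  IsPreDecomp Δ ∧ ∀ x : E, HasSum (fun i => Δ i x) x

/-- The property `U⁺` with constant `C`: the randomized sum is dominated by the plain sum.
(The sum over all sign patterns incorporates the normalization `2^{-|F|}` of the Rademacher
average on the left-hand side.) -/
def UPlusWith [DecidableEq ι] (Δ : ι → (E →L[ℂ] E)) (C : ℝ) : Prop :=
  ∀ (F : Finset ι) (x : E),
    ∑ ε : {i // i ∈ F} → Bool, ‖∑ i : {i // i ∈ F}, rsign (ε i) • Δ i.1 x‖ ^ 2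
      ≤ 2 ^ F.card * (C ^ 2 * ‖∑ i ∈ F, Δ i x‖ ^ 2)

/-- The property `U⁻` with constant `C`. -/
def UMinusWith [DecidableEq ι] (Δ : ι → (E →L[ℂ] E)) (C : ℝ) : Prop :=
  ∀ (F : Finset ι) (x : E),
    (2 : ℝ) ^ F.card * ‖∑ i ∈ F, Δ i x‖ ^ 2
      ≤ C ^ 2 * ∑ ε : {i // i ∈ F} → Bool, ‖∑ i : {i // i ∈ F}, rsign (ε i) • Δ i.1 x‖ ^ 2

end Decomp

/-- The dual (adjoint) operator `T^* : Y^* → X^*`, `v ↦ v ∘ T`. -/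
def dualOp {X Y : Type*} [NormedAddCommGroup X] [NormedSpace ℂ X]
    [NormedAddCommGroup Y] [NormedSpace ℂ Y] (T : X →L[ℂ] Y) :
    (Y →L[ℂ] ℂ) →L[ℂ] (X →L[ℂ] ℂ) :=
  (ContinuousLinearMap.compL ℂ X Y ℂ).flip T

section Extra

/-- The conjugate exponent `t' = t/(t-1)`. -/
def conjExp (t : ℝ) : ℝ := t / (t - 1)

/-- `Z` has Fourier type `t` with constant `FC`: the Fourier transform, defined on
Schwartz functions, is bounded from `L^t(ℝ^n; Z)` to `L^{t'}(ℝ^n; Z)` with norm at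
most `FC`. -/
def FourierTypeWith (n : ℕ) (Z : Type*) [NormedAddCommGroup Z] [NormedSpace ℂ Z]
    (t FC : ℝ) : Prop :=
  0 ≤ FC ∧ ∀ f : 𝓢(Euc n, Z),
    (∫⁻ ξ, (‖𝓕 (⇑f) ξ‖₊ : ℝ≥0∞) ^ conjExp t) ^ (conjExp t)⁻¹
      ≤ ENNReal.ofReal FC * (∫⁻ x, (‖f x‖₊ : ℝ≥0∞) ^ t) ^ t⁻¹

/-- The open annulus `{R₁ < ‖x‖ < R₂}` in `ℝ^n`. -/
def annEuc (n : ℕ) (R₁ R₂ : ℝ) : Set (Euc n) := {x : Euc n | R₁ < ‖x‖ ∧ ‖x‖ < R₂}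

variable {n : ℕ} {X Y : Type*} [NormedAddCommGroup X] [NormedSpace ℂ X]
  [NormedAddCommGroup Y] [NormedSpace ℂ Y]

/-- The approximative kernels `K_N = ∑_{j=-N}^{N} k_j`, where `k_j = 𝓕⁻¹ m_j` and
`m_j(ξ) = φ(2^{-j} ξ) m(ξ)`. -/
def KNker (φ : Euc n → ℝ) (m : Euc n → (X →L[ℂ] Y)) (N : ℕ) : Euc n → (X →L[ℂ] Y) :=
  fun x => ∑ j ∈ Finset.Icc (-(N : ℤ)) (N : ℤ),
    𝓕⁻ (fun ξ => φ ((2 : ℝ) ^ (-j) • ξ) • m ξ) x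

/-- The shift vector `∑_{k : 2^{-k} < ℓ(Q)} w_k 2^{-k}` of a shifted dyadic grid,
for cubes of side length `2^{-j}`. -/
def shiftVec (n : ℕ) (w : ℤ → Fin n → Bool) (j : ℤ) (i : Fin n) : ℝ :=
  ∑' k : {k : ℤ // j < k}, if w k.1 i then (2 : ℝ) ^ (-(k.1 : ℤ)) else 0

/-- The shifted dyadic grid `D^w`. -/
def shiftedDyadicGrid (n : ℕ) (w : ℤ → Fin n → Bool) : Set (Set (Euc n)) :=
  {Q | ∃ (j : ℤ) (mm : Fin n → ℤ), Q = {x : Euc n | ∀ i, x i - shiftVec n w j i ∈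
    Ico ((2 : ℝ) ^ (-j) * mm i) ((2 : ℝ) ^ (-j) * (mm i + 1))}}

/-- A sparse family of cubes with parameter `η`. -/
def IsSparseFam (η : ℝ) (S : Set (Set (Euc n))) : Prop :=
  ∃ Esel : Set (Euc n) → Set (Euc n),
    (∀ Q ∈ S, Esel Q ⊆ Q ∧ MeasurableSet (Esel Q) ∧
      ENNReal.ofReal η * volume Q ≤ volume (Esel Q)) ∧
    S.PairwiseDisjoint Esel

/-- The sparse operator `A_{r,S} g = ∑_{Q ∈ S} (|Q|⁻¹ ∫_Q g^r)^{1/r} 1_Q`. -/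
def sparseOp (r : ℝ) (S : Set (Set (Euc n))) (g : Euc n → ℝ≥0∞) (x : Euc n) : ℝ≥0∞ :=
  ∑' Q : S, Set.indicator (Q : Set (Euc n))
    (fun _ => ((∫⁻ y in (Q : Set (Euc n)), g y ^ r) / volume (Q : Set (Euc n))) ^ r⁻¹) x

/-- The two-weight characteristic `[ω,σ]_{A_p^r(ℝ^n; 𝓠_n)}`. -/
def aprChar (n : ℕ) (p r : ℝ) (ω σ : Euc n → ℝ≥0∞) : ℝ≥0∞ :=
  ⨆ (a : Fin n → ℝ) (h : ℝ) (_ : 0 < h),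
    ((∫⁻ x in cubeOf a h, σ x ^ r) / volume (cubeOf a h)) ^ (1 / r - 1 / p) *
      ((∫⁻ x in cubeOf a h, ω x) / volume (cubeOf a h)) ^ (1 / p)

/-- The Hardy–Littlewood maximal function over axis-parallel cubes, for
`ℝ≥0∞`-valued functions. -/
def maximalFn (n : ℕ) (g : Euc n → ℝ≥0∞) (x : Euc n) : ℝ≥0∞ :=
  ⨆ (a : Fin n → ℝ) (h : ℝ) (_ : 0 < h) (_ : x ∈ cubeOf a h),
    (∫⁻ y in cubeOf a h, g y) / volume (cubeOf a h)

/-- The Fujii–Wilson `A_∞`-characteristic over cubes. -/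
def ainftyChar (n : ℕ) (ω : Euc n → ℝ≥0∞) : ℝ≥0∞ :=
  ⨆ (a : Fin n → ℝ) (h : ℝ) (_ : 0 < h),
    (∫⁻ x in cubeOf a h, maximalFn n (Set.indicator (cubeOf a h) ω) x) /
      (∫⁻ x in cubeOf a h, ω x)

/-- A norming subset of the dual `Y^*`. -/
def IsNorming (Y : Type*) [NormedAddCommGroup Y] [NormedSpace ℂ Y]
    (Nset : Set (Y →L[ℂ] ℂ)) : Prop :=
  ∀ y : Y, ‖y‖ = ⨆ v : {v : Y →L[ℂ] ℂ // v ∈ Nset ∧ ‖v‖ ≤ 1}, ‖(v : Y →L[ℂ] ℂ) y‖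

/-- The Hörmander type condition on the adjoint symbol `m^*`, tested against a set
`Nset ⊆ Y^*`: for all `v^* ∈ Nset`, `R > 0` and `|α| ≤ l`,
`(R^{s|α|-n} ∫_{R<|ξ|<2R} ‖∂^α m^*(ξ) v^*‖^s dξ)^{1/s} ≤ C ‖v^*‖`, the derivatives
existing (classically) on `ℝ^n \ {0}`. -/
def HormCondDual (n : ℕ) (s : ℝ) (l : ℕ) (C : ℝ) (Nset : Set (Y →L[ℂ] ℂ))
    (m : Euc n → (X →L[ℂ] Y)) : Prop :=
  (∀ v ∈ Nset, ∀ α : Fin n → ℕ, (∑ i, α i) < l →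
    DifferentiableOn ℝ (pderivMulti α (fun ξ => dualOp (m ξ) v)) {(0 : Euc n)}ᶜ) ∧
  ∀ v ∈ Nset, ∀ α : Fin n → ℕ, (∑ i, α i) ≤ l → ∀ R : ℝ, 0 < R →
    (ENNReal.ofReal R ^ (s * (∑ i, α i) - n) *
      ∫⁻ ξ in annEuc n R (2 * R),
        (‖pderivMulti α (fun ζ => dualOp (m ζ) v) ξ‖₊ : ℝ≥0∞) ^ s) ^ s⁻¹
      ≤ ENNReal.ofReal (C * ‖v‖)

/-- `T_m` maps `L^q(ℝ^n;X)` boundedly into `L^{q,∞}(ℝ^n;Y)` with norm at most `B`,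
tested on Schwartz functions. -/
def WeakLqBoundOn (q B : ℝ) (m : Euc n → (X →L[ℂ] Y)) : Prop :=
  0 ≤ B ∧ ∀ f : 𝓢(Euc n, X), ∀ lam : ℝ, 0 < lam →
    ENNReal.ofReal lam * (volume {x : Euc n | lam < ‖fourierMult m (⇑f) x‖}) ^ q⁻¹
      ≤ ENNReal.ofReal B * (∫⁻ x, (‖f x‖₊ : ℝ≥0∞) ^ q) ^ q⁻¹

/-- The index blocks `J_k ⊆ ℤ^n`: for `k = l·n + r` (`0 ≤ r < n`),
`J_k = (-∞, l+1]^r × {l+1} × (-∞, l]^{n-r-1}`. -/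
def Jset (n : ℕ) (k : ℤ) : Set (Fin n → ℤ) :=
  {i | (∀ j : Fin n, (j : ℤ) < k % (n : ℤ) → i j ≤ k / (n : ℤ) + 1) ∧
       (∀ j : Fin n, (j : ℤ) = k % (n : ℤ) → i j = k / (n : ℤ) + 1) ∧
       (∀ j : Fin n, k % (n : ℤ) < (j : ℤ) → i j ≤ k / (n : ℤ))}

/-- The product projection `Δ_i = Δ^1_{i_1} ⋯ Δ^n_{i_n}`. -/
def prodProj {E : Type*} [NormedAddCommGroup E] [NormedSpace ℂ E] {n : ℕ}
    {ι : Fin n → Type*} (Δ : ∀ j, ι j → (E →L[ℂ] E)) (i : ∀ j, ι j) : E →L[ℂ] E :=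
  (List.finRange n).foldr (fun j T => (Δ j (i j)).comp T) (ContinuousLinearMap.id ℂ E)

end Extra

end

noncomputable section

section SymmetricBoxes

variable {n : ℕ}

/-- The dual weight `ω^{-1/(q-1)}`, as a measure. -/
def dualMeasure (q : ℝ) (ω : Euc n → ℝ≥0∞) : Measure (Euc n) :=
  volume.withDensity (fun x => ω x ^ (-(q - 1)⁻¹))

/-- The closed box centred at the origin with half side lengths `r`. -/
def symBox (r : Fin n → ℝ) : Set (Euc n) := rectOf (fun i => -r i) r

lemma mem_symBox {r : Fin n → ℝ} {x : Euc n} : x ∈ symBox r ↔ ∀ i, |x i| ≤ r i := by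
  simp [symBox, rectOf, abs_le]

lemma symBox_mono {r s : Fin n → ℝ} (h : ∀ i, r i ≤ s i) : symBox r ⊆ symBox s :=
  fun _ hx => mem_symBox.2 fun i => (mem_symBox.1 hx i).trans (h i)

lemma symBox_eq_preimage (r : Fin n → ℝ) :
    symBox r = (MeasurableEquiv.toLp 2 (Fin n → ℝ)).symm ⁻¹'
      (Set.pi univ fun i => Icc (-r i) (r i)) := by
  ext x
  simp [symBox, rectOf, -pi_univ_Icc]

lemma isCompact_symBox (r : Fin n → ℝ) : IsCompact (symBox r) := by
  rw [symBox_eq_preimage]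
  exact (EuclideanSpace.equiv (Fin n) ℝ).toHomeomorph.isCompact_preimage.2
    (isCompact_univ_pi fun i => isCompact_Icc)

lemma measurableSet_symBox (r : Fin n → ℝ) : MeasurableSet (symBox r) :=
  (isCompact_symBox r).measurableSet

lemma volume_symBox (r : Fin n → ℝ) :
    volume (symBox r) = ∏ i, ENNReal.ofReal (2 * r i) := by
  rw [symBox_eq_preimage, ((EuclideanSpace.volume_preserving_symm_measurableEquiv_toLp
    (Fin n)).measure_preimage_equiv), volume_pi_pi]
  exact Finset.prod_congr rfl fun i _ => by rw [Real.volume_Icc]; ring_nf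

lemma volume_symBox_ne_zero {r : Fin n → ℝ} (hr : ∀ i, 0 < r i) : volume (symBox r) ≠ 0 := by
  rw [volume_symBox]
  exact Finset.prod_ne_zero_iff.2 fun i _ => by simpa using hr i

lemma volume_symBox_ne_top (r : Fin n → ℝ) : volume (symBox r) ≠ ⊤ :=
  (isCompact_symBox r).measure_lt_top.ne

variable {q : ℝ} {ω : Euc n → ℝ≥0∞}

lemma IsWeight.aemeasurable (hω : IsWeight ω) : AEMeasurable ω := hω.1.aemeasurable

lemma IsWeight.dualMeasure_ne_zero (hω : IsWeight ω) (hq : 1 < q) {E : Set (Euc n)}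
    (h0 : volume E ≠ 0) : dualMeasure q ω E ≠ 0 := by
  intro h
  refine h0 (withDensity_absolutelyContinuous' (hω.aemeasurable.pow_const _) ?_ h)
  filter_upwards [hω.2.1] with x hx
  have : ¬ q < 1 := not_lt.2 hq.le
  simp [ENNReal.rpow_eq_zero_iff, hx.1.ne', hx.2.ne]

/-- The Hölder inequality between a weight and its dual weight. -/
lemma IsWeight.volume_rpow_le (hω : IsWeight ω) (hq : 1 < q) (E : Set (Euc n)) :
    volume E ^ q ≤ volume.withDensity ω E * dualMeasure q ω E ^ (q - 1) := by
  have hq0 : 0 < q := by linarith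
  have hq1 : 0 < q - 1 := by linarith
  rw [dualMeasure, withDensity_apply' _ E, withDensity_apply' _ E]
  have hpq : q.HolderConjugate (q / (q - 1)) := .conjExponent hq
  have h1 : volume E = ∫⁻ x in E, ((fun x => ω x ^ q⁻¹) * fun x => ω x ^ (-q⁻¹)) x := by
    rw [← setLIntegral_one]
    refine lintegral_congr_ae (ae_restrict_of_ae ?_)
    filter_upwards [hω.2.1] with x hx
    simp [← ENNReal.rpow_add _ _ hx.1.ne' hx.2.ne]
  have h2 := ENNReal.lintegral_mul_le_Lp_mul_Lq (volume.restrict E) hpq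
    (hω.aemeasurable.pow_const q⁻¹).restrict (hω.aemeasurable.pow_const (-q⁻¹)).restrict
  rw [← h1] at h2
  have h3 : ∀ x, (ω x ^ q⁻¹) ^ q = ω x := fun x => ENNReal.rpow_inv_rpow hq0.ne' _
  have h4 : ∀ x, (ω x ^ (-q⁻¹)) ^ (q / (q - 1)) = ω x ^ (-(q - 1)⁻¹) := fun x => by
    rw [← ENNReal.rpow_mul]
    congr 1
    field_simp
  simp only [h3, h4] at h2
  refine (ENNReal.rpow_le_rpow h2 hq0.le).trans_eq ?_
  rw [ENNReal.mul_rpow_of_nonneg _ _ hq0.le, ← ENNReal.rpow_mul, ← ENNReal.rpow_mul]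
  congr 2
  · rw [one_div, inv_mul_cancel₀ hq0.ne', ENNReal.rpow_one]
  · field_simp

lemma exists_symBox_bound (hq : 1 < q) (hA : rectApChar n q ω ω ≠ ⊤) :
    ∃ C : ℝ≥0∞, C ≠ 0 ∧ C ≠ ⊤ ∧ ∀ r : Fin n → ℝ, (∀ i, 0 < r i) →
      volume.withDensity ω (symBox r) * dualMeasure q ω (symBox r) ^ (q - 1)
        ≤ C * volume (symBox r) ^ q := by
  refine ⟨rectApChar n q ω ω + 1, by simp, by simp [hA], fun r hr => ?_⟩
  have h1 : apSetChar q (symBox r) ω ω ≤ rectApChar n q ω ω :=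
    le_iSup_of_le (fun i => -r i) <| le_iSup_of_le r <|
      le_iSup_of_le (fun i => by linarith [hr i]) le_rfl
  have h0 := volume_symBox_ne_zero hr
  have ht := volume_symBox_ne_top r
  rw [dualMeasure, withDensity_apply _ (measurableSet_symBox r),
    withDensity_apply _ (measurableSet_symBox r)]
  set V := volume (symBox r)
  have h2 : V ^ q = V * V ^ (q - 1) := by
    conv_lhs => rw [show q = 1 + (q - 1) by ring, ENNReal.rpow_add _ _ h0 ht, ENNReal.rpow_one]
  have hV : V ^ (q - 1) ≠ 0 := by simp [ENNReal.rpow_eq_zero_iff, h0, ht]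
  have hV' : V ^ (q - 1) ≠ ⊤ := ENNReal.rpow_ne_top_of_nonneg (by linarith) ht
  have h3 := h1.trans (le_add_of_nonneg_right zero_le_one)
  rw [apSetChar, ENNReal.div_rpow_of_nonneg _ _ (by linarith)] at h3
  rw [h2]
  calc _ = (∫⁻ x in symBox r, ω x) / V *
        ((∫⁻ x in symBox r, ω x ^ (-(q - 1)⁻¹)) ^ (q - 1) / V ^ (q - 1)) * (V * V ^ (q - 1)) := by
        rw [mul_mul_mul_comm, ENNReal.div_mul_cancel h0 ht, ENNReal.div_mul_cancel hV hV']
    _ ≤ _ := by gcongr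

/-- Doubling one side of a box increases its dual measure by at least a fixed amount. -/
lemma IsWeight.exists_dualMeasure_doubling (hω : IsWeight ω) (hq : 1 < q)
    (hA : rectApChar n q ω ω ≠ ⊤) (j : Fin n) {s : ℝ} (hs : 0 < s) :
    ∃ κ : ℝ≥0∞, κ ≠ 0 ∧ ∀ L, s ≤ L →
      dualMeasure q ω (symBox (Function.update (fun _ => s) j L)) + κ
        ≤ dualMeasure q ω (symBox (Function.update (fun _ => s) j (2 * L))) := by
  obtain ⟨C, hC0, hCt, hC⟩ := exists_symBox_bound hq hA
  have hq0 : 0 < q := by linarith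
  have hq1 : 0 < q - 1 := by linarith
  set ν := dualMeasure q ω
  set D : ℝ≥0∞ := C * 2 ^ q
  have hD0 : D ≠ 0 := mul_ne_zero hC0 (by simp [ENNReal.rpow_eq_zero_iff])
  have hDt : D ≠ ⊤ := ENNReal.mul_ne_top hCt (by simp)
  have hν0 : ν (symBox fun _ => s) ≠ 0 :=
    hω.dualMeasure_ne_zero hq (volume_symBox_ne_zero fun _ => hs)
  refine ⟨(ν (symBox fun _ => s) ^ (q - 1) / D) ^ (q - 1)⁻¹, ?_, fun L hL => ?_⟩
  · simp [ENNReal.rpow_eq_zero_iff, ENNReal.div_eq_zero_iff, hν0, hDt, hq1, not_lt.2 hq1.le]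
  have hL0 : 0 < L := hs.trans_le hL
  set R := symBox (Function.update (fun _ => s) j L) with hR
  set R' := symBox (Function.update (fun _ => s) j (2 * L)) with hR'
  have hpos : ∀ M, 0 < M → ∀ i, 0 < Function.update (fun _ => s) j M i := fun M hM i => by
    rcases eq_or_ne i j with rfl | h <;> simp [*]
  have hsub : R ⊆ R' := symBox_mono fun i => by
    rcases eq_or_ne i j with rfl | h <;> simp [*]
  have hsub0 : symBox (fun _ => s) ⊆ R' := symBox_mono fun i => by
    rcases eq_or_ne i j with rfl | h <;> simp [*]
    linarith
  have hRm : MeasurableSet R := measurableSet_symBox _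
  have hRt : volume R ≠ ⊤ := volume_symBox_ne_top _
  have hR0 : volume R ≠ 0 := volume_symBox_ne_zero (hpos L hL0)
  have hvol : volume R' = 2 * volume R := by
    rw [hR, hR', volume_symBox, volume_symBox, ← Finset.mul_prod_erase _ _ (Finset.mem_univ j),
      ← Finset.mul_prod_erase _ (fun i => ENNReal.ofReal (2 * Function.update (fun _ => s) j L i))
        (Finset.mem_univ j), ← mul_assoc]
    congr 1
    · simp only [Function.update_self]
      rw [ENNReal.ofReal_mul zero_le_two, ENNReal.ofReal_ofNat]
    · refine Finset.prod_congr rfl fun i hi => ?_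
      simp [Finset.ne_of_mem_erase hi]
  have hE : volume (R' \ R) = volume R := by
    rw [measure_sdiff hsub hRm.nullMeasurableSet hRt, hvol, two_mul,
      ENNReal.add_sub_cancel_right hRt]
  have key : ν (symBox fun _ => s) ^ (q - 1) ≤ D * ν (R' \ R) ^ (q - 1) := by
    have h1 : volume R ^ q ≠ 0 := by simp [ENNReal.rpow_eq_zero_iff, hR0, hRt]
    have h2 : volume R ^ q ≠ ⊤ := ENNReal.rpow_ne_top_of_nonneg hq0.le hRt
    refine (ENNReal.mul_le_mul_iff_right h1 h2).1 ?_
    calc volume R ^ q * ν (symBox fun _ => s) ^ (q - 1)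
        ≤ (volume.withDensity ω (R' \ R) * ν (R' \ R) ^ (q - 1)) * ν R' ^ (q - 1) := by
          gcongr
          · rw [← hE]; exact hω.volume_rpow_le hq _
      _ ≤ (volume.withDensity ω R' * ν (R' \ R) ^ (q - 1)) * ν R' ^ (q - 1) := by
          gcongr
          exact sdiff_subset
      _ = (volume.withDensity ω R' * ν R' ^ (q - 1)) * ν (R' \ R) ^ (q - 1) := by ring
      _ ≤ (C * volume R' ^ q) * ν (R' \ R) ^ (q - 1) := by
          gcongr ?_ * _
          exact hC _ (hpos (2 * L) (by linarith))
      _ = _ := by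
          rw [hvol, ENNReal.mul_rpow_of_nonneg _ _ hq0.le]
          ring
  rw [← union_eq_self_of_subset_left hsub, ← measure_add_sdiff hRm.nullMeasurableSet R']
  gcongr
  rw [ENNReal.rpow_inv_le_iff hq1]
  exact ENNReal.div_le_of_le_mul' key

/-- The dual measure of boxes elongated in one direction tends to infinity. -/
lemma IsWeight.exists_le_dualMeasure (hω : IsWeight ω) (hq : 1 < q)
    (hA : rectApChar n q ω ω ≠ ⊤) (j : Fin n) {s : ℝ} (hs : 0 < s) {M : ℝ≥0∞} (hM : M ≠ ⊤) :
    ∃ L, s ≤ L ∧ M ≤ dualMeasure q ω (symBox (Function.update (fun _ => s) j L)) := by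
  obtain ⟨κ, hκ0, hκ⟩ := hω.exists_dualMeasure_doubling hq hA j hs
  have h : ∀ m : ℕ, m * κ ≤
      dualMeasure q ω (symBox (Function.update (fun _ => s) j (2 ^ m * s))) := by
    intro m
    induction m with
    | zero => simp
    | succ m ih =>
      refine le_trans ?_ ((hκ (2 ^ m * s) ?_).trans_eq ?_)
      · push_cast
        rw [add_mul, one_mul]
        gcongr
      · exact le_mul_of_one_le_left hs.le (one_le_pow₀ one_le_two)
      · rw [pow_succ']
        ring_nf
  obtain ⟨m, hm⟩ := ENNReal.exists_nat_mul_gt hκ0 hM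
  exact ⟨2 ^ m * s, le_mul_of_one_le_left hs.le (one_le_pow₀ one_le_two), hm.le.trans (h m)⟩

lemma symBox_two_pow_decay {r : Fin n → ℝ} (hn : 1 ≤ n) (hr : ∀ i, 0 < r i)
    {v : Euc n → ℝ≥0∞} {N : ℕ} {x : Euc n}
    (hv : ∀ i, v x ≤ ENNReal.ofReal ((1 + |x i| / r i) ^ N)⁻¹) :
    ∃ k : ℕ, x ∈ symBox (fun i => 2 ^ k * r i) ∧
      v x ≤ ENNReal.ofReal ((2 * (1 / 2) ^ k) ^ N) := by
  classical
  have hex : ∃ k : ℕ, x ∈ symBox (fun i => 2 ^ k * r i) := by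
    have : ∀ i, ∃ k : ℕ, |x i| / r i ≤ 2 ^ k := fun i =>
      (pow_unbounded_of_one_lt (|x i| / r i) one_lt_two).imp fun k hk => hk.le
    choose k hk using this
    refine ⟨∑ i, k i, mem_symBox.2 fun i => (div_le_iff₀ (hr i)).1 ((hk i).trans ?_)⟩
    exact pow_le_pow_right₀ one_le_two (Finset.single_le_sum (fun _ _ => zero_le) (Finset.mem_univ i))
  refine ⟨Nat.find hex, Nat.find_spec hex, ?_⟩
  have key : ∃ i, (2 * (1 / 2) ^ (Nat.find hex) : ℝ)⁻¹ ≤ 1 + |x i| / r i := by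
    rcases Nat.eq_zero_or_pos (Nat.find hex) with h | h
    · rw [h]
      refine ⟨⟨0, hn⟩, ?_⟩
      have : 0 ≤ |x ⟨0, hn⟩| / r ⟨0, hn⟩ := div_nonneg (abs_nonneg _) (hr _).le
      norm_num
      linarith
    · obtain ⟨m, hm⟩ := Nat.exists_eq_succ_of_ne_zero h.ne'
      have := Nat.find_min hex (m := m) (by omega)
      rw [mem_symBox] at this
      push Not at this
      obtain ⟨i, hi⟩ := this
      refine ⟨i, ?_⟩
      rw [← lt_div_iff₀ (hr i)] at hi
      rw [hm, Nat.succ_eq_add_one, pow_succ, one_div, inv_pow]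
      field_simp
      linarith
  obtain ⟨i, hi⟩ := key
  refine (hv i).trans (ENNReal.ofReal_le_ofReal ?_)
  rw [← inv_pow]
  exact pow_le_pow_left₀ (inv_nonneg.2 (add_nonneg zero_le_one
    (div_nonneg (abs_nonneg _) (hr i).le))) (inv_le_of_inv_le₀ (by positivity) hi) _

/-- Weighted `L^q` bound for functions decaying at scale `r`. -/
lemma exists_lintegral_decay_bound (hn : 1 ≤ n) (hq : 1 < q)
    (hA : rectApChar n q ω ω ≠ ⊤) :
    ∃ C : ℝ≥0∞, C ≠ ⊤ ∧ ∀ (r : Fin n → ℝ), (∀ i, 0 < r i) → ∀ v : Euc n → ℝ≥0∞,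
      (∀ x i, v x ≤ ENNReal.ofReal ((1 + |x i| / r i) ^ (n + 1))⁻¹) →
      (∫⁻ x, v x ^ q ∂(volume.withDensity ω)) * dualMeasure q ω (symBox r) ^ (q - 1)
        ≤ C * (∏ i, ENNReal.ofReal (r i)) ^ q := by
  obtain ⟨C, -, hCt, hC⟩ := exists_symBox_bound hq hA
  have hq0 : 0 < q := by linarith
  have hq1 : 0 < q - 1 := by linarith
  set c : ℕ → ℝ≥0∞ := fun k => ENNReal.ofReal ((2 * (1 / 2) ^ k) ^ (n + 1)) ^ q with hc
  set a : ℝ≥0∞ := ENNReal.ofReal (2 ^ (2 * n + 1)) ^ q with ha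
  set b : ℝ≥0∞ := ENNReal.ofReal (1 / 2) ^ q with hb
  have hbt : b < 1 := ENNReal.rpow_lt_one (by norm_num) hq0
  refine ⟨C * (a * (1 - b)⁻¹), ?_, fun r hr v hv => ?_⟩
  · refine ENNReal.mul_ne_top hCt (ENNReal.mul_ne_top ?_ ?_)
    · exact ENNReal.rpow_ne_top_of_nonneg hq0.le ENNReal.ofReal_ne_top
    · exact ENNReal.inv_ne_top.2 (tsub_pos_of_lt hbt).ne'
  set μ := volume.withDensity ω
  set B : ℕ → Set (Euc n) := fun k => symBox (fun i => 2 ^ k * r i)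
  have h1 : ∫⁻ x, v x ^ q ∂μ ≤ ∑' k, c k * μ (B k) := by
    calc ∫⁻ x, v x ^ q ∂μ ≤ ∫⁻ x, ∑' k, (B k).indicator (fun _ => c k) x ∂μ := by
          refine lintegral_mono fun x => ?_
          obtain ⟨k, hk, hvk⟩ := symBox_two_pow_decay hn hr (hv x)
          refine le_trans ?_ (ENNReal.le_tsum k)
          rw [indicator_of_mem hk]
          exact ENNReal.rpow_le_rpow hvk hq0.le
      _ = _ := by
          rw [lintegral_tsum fun k =>
            (measurable_const.indicator (measurableSet_symBox _)).aemeasurable]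
          refine tsum_congr fun k => ?_
          rw [lintegral_indicator_const (measurableSet_symBox _)]
  have h2 : ∀ k, c k * μ (B k) * dualMeasure q ω (symBox r) ^ (q - 1)
      ≤ C * (a * b ^ k) * (∏ i, ENNReal.ofReal (r i)) ^ q := by
    intro k
    have hsub : symBox r ⊆ B k := symBox_mono fun i =>
      le_mul_of_one_le_left (hr i).le (one_le_pow₀ one_le_two)
    calc c k * μ (B k) * dualMeasure q ω (symBox r) ^ (q - 1)
        ≤ c k * (μ (B k) * dualMeasure q ω (B k) ^ (q - 1)) := by
          rw [mul_assoc]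
          gcongr
      _ ≤ c k * (C * volume (B k) ^ q) := by
          gcongr _ * ?_
          exact hC _ fun i => mul_pos (by positivity) (hr i)
      _ = C * (c k * volume (B k) ^ q) := by ring
      _ = C * ((a * b ^ k) * (∏ i, ENNReal.ofReal (r i)) ^ q) := by
          congr 1
          have hvol : volume (B k)
              = ENNReal.ofReal ((2 * 2 ^ k) ^ n) * ∏ i, ENNReal.ofReal (r i) := by
            rw [volume_symBox]
            simp_rw [← mul_assoc]
            simp_rw [ENNReal.ofReal_mul (show (0 : ℝ) ≤ 2 * 2 ^ k by positivity)]
            rw [Finset.prod_mul_distrib, Finset.prod_const, Finset.card_univ, Fintype.card_fin,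
              ENNReal.ofReal_pow (by positivity)]
          have hbk : b ^ k = ENNReal.ofReal ((1 / 2) ^ k) ^ q := by
            rw [hb, ENNReal.ofReal_pow (by norm_num), ← ENNReal.rpow_natCast, ← ENNReal.rpow_natCast,
              ← ENNReal.rpow_mul, ← ENNReal.rpow_mul, mul_comm]
          have hck : c k * ENNReal.ofReal ((2 * 2 ^ k) ^ n) ^ q = a * b ^ k := by
            rw [hbk, hc, ha, ← ENNReal.mul_rpow_of_nonneg _ _ hq0.le,
              ← ENNReal.mul_rpow_of_nonneg _ _ hq0.le, ← ENNReal.ofReal_mul (by positivity),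
              ← ENNReal.ofReal_mul (by positivity)]
            congr 2
            have hy : (2 : ℝ) ^ k ≠ 0 := by positivity
            rw [one_div, inv_pow]
            generalize (2 : ℝ) ^ k = y at hy
            rw [mul_pow, mul_pow, inv_pow, pow_succ y, mul_inv]
            field_simp
            ring
          rw [hvol, ENNReal.mul_rpow_of_nonneg _ _ hq0.le, ← mul_assoc, hck]
      _ = _ := by ring
  calc (∫⁻ x, v x ^ q ∂μ) * dualMeasure q ω (symBox r) ^ (q - 1)
      ≤ (∑' k, c k * μ (B k)) * dualMeasure q ω (symBox r) ^ (q - 1) := by gcongr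
    _ = ∑' k, c k * μ (B k) * dualMeasure q ω (symBox r) ^ (q - 1) := by rw [ENNReal.tsum_mul_right]
    _ ≤ ∑' k, C * (a * b ^ k) * (∏ i, ENNReal.ofReal (r i)) ^ q := ENNReal.tsum_le_tsum h2
    _ = _ := by
      rw [ENNReal.tsum_mul_right, ENNReal.tsum_mul_left, ENNReal.tsum_mul_left,
        ENNReal.tsum_geometric]

end SymmetricBoxes
end

noncomputable section

section Kernels

/-- The `L¹`-normalised dilation `t ↦ a k(a t)` of a function on the line. -/
def dilate (a : ℝ) (k : ℝ → ℂ) : ℝ → ℂ := fun t => a * k (a * t)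

lemma exists_fourier_cutoff :
    ∃ k : 𝓢(ℝ, ℂ), (∀ ξ : ℝ, |ξ| ≤ 1 → 𝓕 (k : ℝ → ℂ) ξ = 1) ∧
      ∀ ξ : ℝ, 2 ≤ |ξ| → 𝓕 (k : ℝ → ℂ) ξ = 0 := by
  let b : ContDiffBump (0 : ℝ) := ⟨1, 2, by norm_num, by norm_num⟩
  have hs : HasCompactSupport (fun x => (b x : ℂ)) :=
    b.hasCompactSupport.comp_left (g := fun t : ℝ => (t : ℂ)) (by simp)
  have hd : ContDiff ℝ (⊤ : ℕ∞) (fun x => (b x : ℂ)) :=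
    Complex.ofRealCLM.contDiff.comp b.contDiff
  let θ : 𝓢(ℝ, ℂ) := hs.toSchwartzMap hd
  have hθ : 𝓕 ((𝓕⁻ θ : 𝓢(ℝ, ℂ)) : ℝ → ℂ) = fun x => (b x : ℂ) := by
    rw [← SchwartzMap.fourier_coe, FourierTransform.fourier_fourierInv_eq]
    rfl
  refine ⟨𝓕⁻ θ, fun ξ hξ => ?_, fun ξ hξ => ?_⟩
  · rw [hθ]
    simp only [Complex.ofReal_eq_one]
    exact b.one_of_mem_closedBall (by simpa using hξ)
  · rw [hθ]
    simp only [Complex.ofReal_eq_zero]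
    exact b.zero_of_le_dist (by simpa using hξ)

lemma integrable_dilate {a : ℝ} (ha : a ≠ 0) {k : ℝ → ℂ} (hk : Integrable k) :
    Integrable (dilate a k) :=
  (hk.comp_mul_left' ha).const_mul _

lemma continuous_dilate (a : ℝ) {k : ℝ → ℂ} (hk : Continuous k) : Continuous (dilate a k) := by
  unfold dilate
  fun_prop

lemma fourier_dilate {a : ℝ} (ha : 0 < a) (k : ℝ → ℂ) (ξ : ℝ) :
    𝓕 (dilate a k) ξ = 𝓕 k (ξ / a) := by
  rw [Real.fourier_real_eq, Real.fourier_real_eq]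
  have h := Measure.integral_comp_mul_left
    (fun v => Real.fourierChar (-(v * (ξ / a))) • k v) a
  have h' : ∀ t, Real.fourierChar (-(t * ξ)) • dilate a k t
      = (a : ℂ) * (Real.fourierChar (-(a * t * (ξ / a))) • k (a * t)) := by
    intro t
    have : a * t * (ξ / a) = t * ξ := by field_simp
    rw [this, dilate, mul_smul_comm]
  simp_rw [h']
  rw [integral_const_mul, h, abs_of_pos (inv_pos.2 ha), ← Complex.coe_smul, smul_eq_mul,
    ← mul_assoc]
  simp [ha.ne']

variable {n : ℕ}

lemma integrable_tensor {𝕜 : Type*} [RCLike 𝕜] {κ : Fin n → ℝ → 𝕜} (hκ : ∀ i, Integrable (κ i)) :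
    Integrable (fun x : Euc n => ∏ i, κ i (x i)) :=
  ((EuclideanSpace.volume_preserving_symm_measurableEquiv_toLp (Fin n)).integrable_comp_emb
    (MeasurableEquiv.measurableEmbedding _)).2 (Integrable.fintype_prod hκ)

lemma integral_tensor {𝕜 : Type*} [RCLike 𝕜] (κ : Fin n → ℝ → 𝕜) :
    ∫ x : Euc n, ∏ i, κ i (x i) = ∏ i, ∫ t, κ i t := by
  rw [← integral_fintype_prod_volume_eq_prod]
  exact (EuclideanSpace.volume_preserving_symm_measurableEquiv_toLp (Fin n)).integral_comp
    (MeasurableEquiv.measurableEmbedding _) (fun x => ∏ i, κ i (x i))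

lemma fourier_tensor (κ : Fin n → ℝ → ℂ) (ξ : Euc n) :
    𝓕 (fun x : Euc n => ∏ i, κ i (x i)) ξ = ∏ i, 𝓕 (κ i) (ξ i) := by
  simp_rw [Real.fourier_eq', smul_eq_mul]
  rw [← integral_tensor]
  congr 1 with x
  rw [Finset.prod_mul_distrib, ← Complex.exp_sum, ← Finset.sum_mul, PiLp.inner_apply,
    Finset.mul_sum]
  push_cast
  rfl

end Kernels
end

noncomputable section

section Spectrum

variable {n : ℕ} {X : Type*} [NormedAddCommGroup X] [NormedSpace ℂ X]

lemma contDiff_fourier_of_hasCompactSupport {f : Euc n → X} (hf : Continuous f)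
    (hfc : HasCompactSupport f) : ContDiff ℝ (⊤ : ℕ∞) (𝓕 f) :=
  Real.contDiff_fourier fun m _ =>
    (by fun_prop : Continuous fun v => ‖v‖ ^ m * ‖f v‖).integrable_of_hasCompactSupport
      hfc.norm.mul_left

lemma fourier_dilate_sub_dilate {k : 𝓢(ℝ, ℂ)} {l δ : ℝ} (hl : 0 < l) (hδ : 0 < δ) (ξ : ℝ) :
    𝓕 (dilate l k - dilate δ k) ξ = 𝓕 (k : ℝ → ℂ) (ξ / l) - 𝓕 (k : ℝ → ℂ) (ξ / δ) := by
  have h : 𝓕 (dilate l k - dilate δ k) ξ = 𝓕 (dilate l k) ξ - 𝓕 (dilate δ k) ξ := by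
    simp only [Real.fourier_eq, Pi.sub_apply, smul_sub]
    exact integral_sub
      ((Real.fourierIntegral_convergent_iff ξ).2 (integrable_dilate hl.ne' k.integrable))
      ((Real.fourierIntegral_convergent_iff ξ).2 (integrable_dilate hδ.ne' k.integrable))
  rw [h, fourier_dilate hl, fourier_dilate hδ]

lemma exists_fourierInv_eq [CompleteSpace X] {k : 𝓢(ℝ, ℂ)}
    (hk1 : ∀ ξ : ℝ, |ξ| ≤ 1 → 𝓕 (k : ℝ → ℂ) ξ = 1)
    (hk0 : ∀ ξ : ℝ, 2 ≤ |ξ| → 𝓕 (k : ℝ → ℂ) ξ = 0) {l δ : ℝ} (hδ : 0 < δ) (hl : δ ≤ l)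
    {f : Euc n → X} (hf : Continuous f) (hfc : HasCompactSupport f) :
    ∃ g : Euc n → X, ContDiff ℝ (⊤ : ℕ∞) g ∧ HasCompactSupport g ∧
      tsupport g ⊆ {ξ : Euc n | ∀ i, ξ i ≠ 0} ∧
      𝓕⁻ g = fun x => ∫ t : Euc n, (∏ i, (dilate l k - dilate δ k) (t i)) • f (x - t) := by
  have hl0 : 0 < l := hδ.trans_le hl
  set κ : ℝ → ℂ := dilate l k - dilate δ k with hκ
  have hκi : Integrable κ :=
    (integrable_dilate hl0.ne' k.integrable).sub (integrable_dilate hδ.ne' k.integrable)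
  have hfκ : ∀ ξ, 𝓕 κ ξ = 𝓕 (k : ℝ → ℂ) (ξ / l) - 𝓕 (k : ℝ → ℂ) (ξ / δ) :=
    fourier_dilate_sub_dilate hl0 hδ
  have hsm : ContDiff ℝ (⊤ : ℕ∞) (𝓕 κ) := by
    have hk : ContDiff ℝ (⊤ : ℕ∞) (𝓕 (k : ℝ → ℂ)) := by
      rw [← SchwartzMap.fourier_coe]
      exact SchwartzMap.smooth _ _
    rw [funext hfκ]
    exact (hk.comp (contDiff_id.div_const l)).sub (hk.comp (contDiff_id.div_const δ))
  have hzero : ∀ ξ : ℝ, |ξ| ∉ Icc δ (2 * l) → 𝓕 κ ξ = 0 := by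
    intro ξ hξ
    rw [hfκ]
    by_cases h : |ξ| < δ
    · rw [hk1, hk1, sub_self]
      · rw [abs_div, abs_of_pos hδ, div_le_one hδ]
        exact h.le
      · rw [abs_div, abs_of_pos hl0, div_le_one hl0]
        exact h.le.trans hl
    · have h2 : 2 * l < |ξ| := by
        by_contra h2
        exact hξ ⟨not_lt.1 h, not_lt.1 h2⟩
      rw [hk0, hk0, sub_self]
      · rw [abs_div, abs_of_pos hδ, le_div_iff₀ hδ]
        linarith
      · rw [abs_div, abs_of_pos hl0, le_div_iff₀ hl0]
        exact h2.le
  set Q : Euc n → ℂ := fun t => ∏ i, κ (t i) with hQ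
  have hQi : Integrable Q := integrable_tensor fun _ => hκi
  have hfi : Integrable f := hf.integrable_of_hasCompactSupport hfc
  set h : Euc n → X := convolution Q f (ContinuousLinearMap.lsmul ℂ ℂ) volume with hh
  have hhc : Continuous h := hfc.continuous_convolution_right _ hQi.locallyIntegrable hf
  have hhi : Integrable h := hQi.integrable_convolution _ hfi
  have hFh : 𝓕 h = fun ξ : Euc n => (∏ i, 𝓕 κ (ξ i)) • 𝓕 f ξ := by
    ext ξ
    rw [hh, Real.fourier_smul_convolution_eq hQi hfi, hQ, fourier_tensor]
  set S : Set (Euc n) := {ξ | ∀ i, |ξ i| ∈ Icc δ (2 * l)} with hS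
  have hsupp : Function.support (𝓕 h) ⊆ S := by
    intro ξ hξ i
    by_contra hi
    refine hξ ?_
    rw [hFh]
    simp only
    rw [Finset.prod_eq_zero (Finset.mem_univ i) (hzero _ hi), zero_smul]
  have hScl : IsClosed S := by
    rw [hS, ofPred_forall]
    exact isClosed_iInter fun i => isClosed_Icc.preimage (by fun_prop)
  have hSc : IsCompact S :=
    (isCompact_symBox fun _ => 2 * l).of_isClosed_subset hScl
      fun ξ hξ => mem_symBox.2 fun i => (hξ i).2
  have hcs : HasCompactSupport (𝓕 h) := HasCompactSupport.of_support_subset_isCompact hSc hsupp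
  have hcd : ContDiff ℝ (⊤ : ℕ∞) (𝓕 h) := by
    rw [hFh]
    refine ContDiff.smul (contDiff_prod fun i _ => ?_)
      (contDiff_fourier_of_hasCompactSupport hf hfc)
    exact hsm.comp (by fun_prop)
  refine ⟨𝓕 h, hcd, hcs, ?_, ?_⟩
  · refine (closure_minimal hsupp hScl).trans fun ξ hξ i hi => ?_
    have := (hξ i).1
    rw [hi, abs_zero] at this
    linarith
  · rw [hhc.fourierInv_fourier_eq hhi (hcd.continuous.integrable_of_hasCompactSupport hcs)]
    rfl

end Spectrum
end

noncomputable section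

section Bounds

lemma SchwartzMap.exists_one_add_pow_mul_le (k : 𝓢(ℝ, ℂ)) (N : ℕ) :
    ∃ C, 0 ≤ C ∧ ∀ t : ℝ, (1 + |t|) ^ N * ‖k t‖ ≤ C := by
  have h : ∀ t : ℝ, (1 + |t|) ^ N * ‖k t‖ ≤
      2 ^ N * ((Finset.Iic (N, 0)).sup fun m => SchwartzMap.seminorm ℂ m.1 m.2) k := fun t => by
    simpa using
      SchwartzMap.one_add_le_sup_seminorm_apply (𝕜 := ℂ) (m := (N, 0)) le_rfl le_rfl k t
  exact ⟨_, le_trans (by positivity) (h 0), h⟩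

lemma SchwartzMap.integrable_one_add_pow_mul (k : 𝓢(ℝ, ℂ)) (N : ℕ) :
    Integrable fun t : ℝ => (1 + |t|) ^ N * ‖k t‖ := by
  have h : Integrable fun t : ℝ => 2 ^ (N - 1) * (‖t‖ ^ 0 * ‖k t‖ + ‖t‖ ^ N * ‖k t‖) :=
    ((k.integrable_pow_mul volume 0).add (k.integrable_pow_mul volume N)).const_mul _
  refine h.mono' (Continuous.aestronglyMeasurable (by fun_prop)) (ae_of_all _ fun t => ?_)
  rw [Real.norm_of_nonneg (by positivity), ← add_mul, ← mul_assoc]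
  gcongr
  simpa using add_pow_le (zero_le_one' ℝ) (abs_nonneg t) N

lemma one_add_abs_le_mul {a x y ρ : ℝ} (ha : 0 ≤ a) (hρ : 0 ≤ ρ) (hy : y ∈ Icc (-ρ) ρ) :
    1 + a * |x| ≤ (1 + a * ρ) * (1 + |a * (x - y)|) := by
  have hy' : |y| ≤ ρ := abs_le.2 hy
  have h1 : |x| ≤ |x - y| + |y| := by simpa using abs_add_le (x - y) y
  rw [abs_mul, abs_of_nonneg ha]
  nlinarith [mul_le_mul_of_nonneg_left (h1.trans (add_le_add_right hy' _)) ha,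
    mul_nonneg (mul_nonneg ha hρ) (mul_nonneg ha (abs_nonneg (x - y)))]

/-- The dilated kernels have uniform polynomial decay after averaging over a fixed interval. -/
lemma SchwartzMap.exists_dilate_bound_of_one_le (k : 𝓢(ℝ, ℂ)) (N : ℕ) {ρ : ℝ} (hρ : 0 ≤ ρ) :
    ∃ B, 0 ≤ B ∧ ∀ a, 1 ≤ a → ∀ x,
      ∫ y in Icc (-ρ) ρ, ‖dilate a k (x - y)‖ ≤ B * ((1 + |x|) ^ N)⁻¹ := by
  set ψ : ℝ → ℝ := fun t => (1 + |t|) ^ N * ‖k t‖ with hψ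
  have hψi : Integrable ψ := k.integrable_one_add_pow_mul N
  have hψ0 : ∀ t, 0 ≤ ψ t := fun t => by positivity
  refine ⟨(1 + ρ) ^ N * ∫ t, ψ t, mul_nonneg (by positivity) (integral_nonneg hψ0),
    fun a ha x => ?_⟩
  have ha0 : 0 < a := by linarith
  have hi : Integrable fun y => a * ψ (a * (x - y)) :=
    ((hψi.comp_mul_left' ha0.ne').const_mul a).comp_sub_left x
  calc ∫ y in Icc (-ρ) ρ, ‖dilate a k (x - y)‖
      ≤ ∫ y in Icc (-ρ) ρ, ((1 + ρ) ^ N * ((1 + |x|) ^ N)⁻¹) * (a * ψ (a * (x - y))) := by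
        refine setIntegral_mono_on ?_ (hi.const_mul _).integrableOn measurableSet_Icc
          fun y hy => ?_
        · exact (((integrable_dilate ha0.ne' k.integrable).comp_sub_left x).norm).integrableOn
        · have h1 : 1 + |x| ≤ (1 + ρ) * (1 + |a * (x - y)|) := by
            have h := one_add_abs_le_mul (a := 1) (x := x) zero_le_one hρ hy
            simp only [one_mul] at h
            have h' : |x - y| ≤ |a * (x - y)| := by
              rw [abs_mul, abs_of_pos ha0]
              exact le_mul_of_one_le_left (abs_nonneg _) ha
            exact h.trans (by gcongr)
          have h2 : 1 ≤ (1 + ρ) ^ N * ((1 + |x|) ^ N)⁻¹ * (1 + |a * (x - y)|) ^ N := by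
            rw [mul_right_comm, ← mul_pow, ← div_eq_mul_inv, one_le_div (by positivity)]
            exact pow_le_pow_left₀ (by positivity) h1 N
          rw [dilate, norm_mul, Complex.norm_real, Real.norm_of_nonneg ha0.le, hψ]
          calc a * ‖k (a * (x - y))‖ = 1 * (a * ‖k (a * (x - y))‖) := (one_mul _).symm
            _ ≤ ((1 + ρ) ^ N * ((1 + |x|) ^ N)⁻¹ * (1 + |a * (x - y)|) ^ N)
                * (a * ‖k (a * (x - y))‖) := by gcongr
            _ = _ := by ring
    _ ≤ ∫ y, ((1 + ρ) ^ N * ((1 + |x|) ^ N)⁻¹) * (a * ψ (a * (x - y))) := by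
        refine setIntegral_le_integral (hi.const_mul _) (ae_of_all _ fun y => ?_)
        have := hψ0 (a * (x - y))
        simp only [Pi.zero_apply]
        positivity
    _ = (1 + ρ) ^ N * (∫ t, ψ t) * ((1 + |x|) ^ N)⁻¹ := by
        rw [integral_const_mul, integral_const_mul,
          integral_sub_left_eq_self (fun t => ψ (a * t)) volume x,
          Measure.integral_comp_mul_left, abs_of_pos (inv_pos.2 ha0), smul_eq_mul]
        field_simp

lemma SchwartzMap.exists_dilate_bound_of_le (k : 𝓢(ℝ, ℂ)) (N : ℕ) {ρ l : ℝ} (hρ : 0 ≤ ρ)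
    (hl : 0 ≤ l) :
    ∃ B, 0 ≤ B ∧ ∀ a, 0 < a → a ≤ l → ∀ x,
      ∫ y in Icc (-ρ) ρ, ‖dilate a k (x - y)‖ ≤ B * (a * ((1 + a * |x|) ^ N)⁻¹) := by
  obtain ⟨C, hC0, hC⟩ := k.exists_one_add_pow_mul_le N
  refine ⟨2 * ρ * ((1 + l * ρ) ^ N * C), by positivity, fun a ha hal x => ?_⟩
  have hb : ∀ y ∈ Icc (-ρ) ρ, ‖dilate a k (x - y)‖
      ≤ a * ((1 + l * ρ) ^ N * C * ((1 + a * |x|) ^ N)⁻¹) := by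
    intro y hy
    have h1 : 1 + a * |x| ≤ (1 + l * ρ) * (1 + |a * (x - y)|) :=
      (one_add_abs_le_mul ha.le hρ hy).trans (by gcongr)
    rw [dilate, norm_mul, Complex.norm_real, Real.norm_of_nonneg ha.le, ← div_eq_mul_inv]
    gcongr
    rw [le_div_iff₀ (by positivity)]
    calc ‖k (a * (x - y))‖ * (1 + a * |x|) ^ N
        ≤ ‖k (a * (x - y))‖ * ((1 + l * ρ) * (1 + |a * (x - y)|)) ^ N := by gcongr
      _ = (1 + l * ρ) ^ N * ((1 + |a * (x - y)|) ^ N * ‖k (a * (x - y))‖) := by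
        rw [mul_pow]
        ring
      _ ≤ (1 + l * ρ) ^ N * C := by gcongr; exact hC _
  have h := norm_setIntegral_le_of_norm_le_const (μ := volume) (s := Icc (-ρ) ρ)
    (f := fun y => ‖dilate a k (x - y)‖) (by simp) (fun y hy => by simpa using hb y hy)
  refine (Real.le_norm_self _).trans (h.trans_eq ?_)
  rw [Real.volume_real_Icc_of_le (by linarith)]
  ring

variable {n : ℕ} {X : Type*} [NormedAddCommGroup X] [NormedSpace ℂ X]

/-- Pointwise bound for the convolution of a kernel dominated by a sum of tensor products with a
bounded function supported in a box. -/
lemma norm_integral_smul_le_of_tensor {Q : Euc n → ℂ} {f : Euc n → X} {M ρ : ℝ}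
    (hM : ∀ x, ‖f x‖ ≤ M) (hf : ∀ x, x ∉ symBox (fun _ : Fin n => ρ) → f x = 0)
    {σ : Type*} (s : Finset σ) {G B : σ → Fin n → ℝ → ℝ} (hG : ∀ j i, Continuous (G j i))
    (hG0 : ∀ j i t, 0 ≤ G j i t) (hQ : ∀ t : Euc n, ‖Q t‖ ≤ ∑ j ∈ s, ∏ i, G j i (t i))
    (hB : ∀ j ∈ s, ∀ i x, ∫ y in Icc (-ρ) ρ, G j i (x - y) ≤ B j i x) (x : Euc n) :
    ‖∫ t : Euc n, Q t • f (x - t)‖ ≤ M * ∑ j ∈ s, ∏ i, B j i (x i) := by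
  have hM0 : 0 ≤ M := (norm_nonneg _).trans (hM 0)
  set H : σ → Fin n → ℝ → ℝ :=
    fun j i => (Icc (-ρ) ρ).indicator fun y => G j i (x i - y) with hH
  have hHi : ∀ j i, Integrable (H j i) := fun j i =>
    (Continuous.integrableOn_Icc ((hG j i).comp (by fun_prop))).integrable_indicator
      measurableSet_Icc
  have hH0 : ∀ j i y, 0 ≤ H j i y := fun j i y => indicator_nonneg (fun _ _ => hG0 _ _ _) y
  have hbound : ∀ y : Euc n, ‖Q (x - y) • f y‖ ≤ M * ∑ j ∈ s, ∏ i, H j i (y i) := by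
    intro y
    by_cases hy : y ∈ symBox (fun _ : Fin n => ρ)
    · have h1 : ∀ j i, H j i (y i) = G j i ((x - y) i) := fun j i =>
        indicator_of_mem (mem_Icc.2 (abs_le.1 (mem_symBox.1 hy i))) _
      simp_rw [h1]
      rw [norm_smul, mul_comm]
      exact mul_le_mul (hM y) (hQ _) (norm_nonneg _) hM0
    · rw [hf y hy, smul_zero, norm_zero]
      exact mul_nonneg hM0 (Finset.sum_nonneg fun j _ => Finset.prod_nonneg fun i _ => hH0 _ _ _)
  have hint : ∀ j, Integrable fun y : Euc n => ∏ i, H j i (y i) :=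
    fun j => integrable_tensor (hHi j)
  calc ‖∫ t : Euc n, Q t • f (x - t)‖ = ‖∫ y : Euc n, Q (x - y) • f y‖ := by
        rw [← integral_sub_left_eq_self (fun t => Q t • f (x - t)) volume x]
        simp
    _ ≤ ∫ y : Euc n, M * ∑ j ∈ s, ∏ i, H j i (y i) :=
        norm_integral_le_of_norm_le ((integrable_finsetSum s fun j _ => hint j).const_mul M)
          (ae_of_all _ hbound)
    _ = M * ∑ j ∈ s, ∏ i, ∫ y, H j i y := by
        rw [integral_const_mul, integral_finsetSum s fun j _ => hint j]
        simp_rw [integral_tensor]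
    _ ≤ M * ∑ j ∈ s, ∏ i, B j i (x i) := by
        gcongr with j hj i _
        · exact fun i _ => integral_nonneg (hH0 j i)
        · rw [hH, integral_indicator measurableSet_Icc]
          exact hB j hj i (x i)

end Bounds
end

noncomputable section

section Tails

variable {n : ℕ} {ω : Euc n → ℝ≥0∞} {p : ℝ≥0∞}

/-- The tensor product of the one-dimensional kernels `a i (1 + a i |t|)^{-(n+1)}`. -/
def tailKernel (a : Fin n → ℝ) (x : Euc n) : ℝ :=
  ∏ i, (a i * ((1 + a i * |x i|) ^ (n + 1))⁻¹)

lemma tailKernel_nonneg {a : Fin n → ℝ} (ha : ∀ i, 0 < a i) (x : Euc n) : 0 ≤ tailKernel a x :=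
  Finset.prod_nonneg fun i _ => by have := ha i; positivity

lemma measurable_tailKernel (a : Fin n → ℝ) : Measurable (tailKernel a) := by
  unfold tailKernel
  fun_prop

lemma exists_eLpNorm_tailKernel_bound (hn : 1 ≤ n) (hp : 1 < p) (hpt : p ≠ ⊤)
    (hA : rectApChar n p.toReal ω ω ≠ ⊤) :
    ∃ C : ℝ≥0∞, C ≠ ⊤ ∧ ∀ a : Fin n → ℝ, (∀ i, 0 < a i) →
      eLpNorm (tailKernel a) p (volume.withDensity ω) ^ p.toReal *
        dualMeasure p.toReal ω (symBox fun i => (a i)⁻¹) ^ (p.toReal - 1) ≤ C := by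
  have hq : 1 < p.toReal := by
    simpa using (ENNReal.toReal_lt_toReal ENNReal.one_ne_top hpt).2 hp
  have hq0 : 0 < p.toReal := by linarith
  obtain ⟨C, hC, h⟩ := exists_lintegral_decay_bound hn hq hA
  refine ⟨C, hC, fun a ha => ?_⟩
  set P : ℝ≥0∞ := ∏ i, ENNReal.ofReal (a i) with hP
  set v : Euc n → ℝ≥0∞ := fun x => ∏ i, ENNReal.ofReal ((1 + a i * |x i|) ^ (n + 1))⁻¹ with hv
  have hPinv : P * ∏ i, ENNReal.ofReal (a i)⁻¹ = 1 := by
    rw [hP, ← Finset.prod_mul_distrib]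
    refine Finset.prod_eq_one fun i _ => ?_
    rw [← ENNReal.ofReal_mul (ha i).le, mul_inv_cancel₀ (ha i).ne', ENNReal.ofReal_one]
  have hfac : ∀ x : Euc n, ‖tailKernel a x‖ₑ = P * v x := by
    intro x
    rw [Real.enorm_of_nonneg (tailKernel_nonneg ha x), tailKernel,
      ENNReal.ofReal_prod_of_nonneg fun i _ => by have := ha i; positivity, hP, hv,
      ← Finset.prod_mul_distrib]
    exact Finset.prod_congr rfl fun i _ => ENNReal.ofReal_mul (ha i).le
  have hvle : ∀ x i, v x ≤ ENNReal.ofReal ((1 + |x i| / (a i)⁻¹) ^ (n + 1))⁻¹ := by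
    intro x i
    have h1 : ∀ j ∈ Finset.univ, ENNReal.ofReal ((1 + a j * |x j|) ^ (n + 1))⁻¹ ≤ 1 := by
      intro j _
      rw [ENNReal.ofReal_le_one]
      refine inv_le_one_of_one_le₀ (one_le_pow₀ ?_)
      have := mul_nonneg (ha j).le (abs_nonneg (x j))
      linarith
    rw [div_inv_eq_mul, mul_comm |x i|, hv]
    simp only
    rw [← Finset.mul_prod_erase _ _ (Finset.mem_univ i)]
    exact mul_le_of_le_one_right' (Finset.prod_le_one' fun j hj => h1 j (Finset.mem_univ j))
  have key := h (fun i => (a i)⁻¹) (fun i => inv_pos.2 (ha i)) v hvle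
  have hnorm : eLpNorm (tailKernel a) p (volume.withDensity ω) ^ p.toReal
      = P ^ p.toReal * ∫⁻ x, v x ^ p.toReal ∂(volume.withDensity ω) := by
    rw [eLpNorm_eq_lintegral_rpow_enorm_toReal (by positivity) hpt, ← ENNReal.rpow_mul,
      one_div_mul_cancel hq0.ne', ENNReal.rpow_one]
    simp_rw [hfac, ENNReal.mul_rpow_of_nonneg _ _ hq0.le]
    rw [lintegral_const_mul']
    exact ENNReal.rpow_ne_top_of_nonneg hq0.le
      (ENNReal.prod_ne_top fun i _ => ENNReal.ofReal_ne_top)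
  calc _ = P ^ p.toReal * ((∫⁻ x, v x ^ p.toReal ∂(volume.withDensity ω)) *
        dualMeasure p.toReal ω (symBox fun i => (a i)⁻¹) ^ (p.toReal - 1)) := by
        rw [hnorm, mul_assoc]
    _ ≤ P ^ p.toReal * (C * (∏ i, ENNReal.ofReal (a i)⁻¹) ^ p.toReal) := by gcongr
    _ = C := by
        rw [mul_left_comm, ← ENNReal.mul_rpow_of_nonneg _ _ hq0.le, hPinv, ENNReal.one_rpow,
          mul_one]

lemma IsWeight.memLp_tailKernel (hω : IsWeight ω) (hn : 1 ≤ n) (hp : 1 < p) (hpt : p ≠ ⊤)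
    (hA : rectApChar n p.toReal ω ω ≠ ⊤) {a : Fin n → ℝ} (ha : ∀ i, 0 < a i) :
    MemLp (tailKernel a) p (volume.withDensity ω) := by
  have hq : 1 < p.toReal := by
    simpa using (ENNReal.toReal_lt_toReal ENNReal.one_ne_top hpt).2 hp
  obtain ⟨C, hC, h⟩ := exists_eLpNorm_tailKernel_bound hn hp hpt hA
  refine ⟨(measurable_tailKernel a).aestronglyMeasurable, lt_top_iff_ne_top.2 fun htop => ?_⟩
  have h0 := hω.dualMeasure_ne_zero hq
    (volume_symBox_ne_zero (r := fun i => (a i)⁻¹) fun i => inv_pos.2 (ha i))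
  have := h a ha
  rw [htop, ENNReal.top_rpow_of_pos (by linarith), ENNReal.top_mul, top_le_iff] at this
  · exact hC this
  · rw [Ne, ENNReal.rpow_eq_zero_iff]
    rintro (h | h)
    · exact h0 h.1
    · linarith [h.2]

/-- The tail kernels become small in the weighted space when some of the scales tend to zero. -/
lemma IsWeight.exists_eLpNorm_tailKernel_le (hω : IsWeight ω) (hn : 1 ≤ n) (hp : 1 < p)
    (hpt : p ≠ ⊤) (hA : rectApChar n p.toReal ω ω ≠ ⊤) {l : ℝ} (hl : 0 < l) {ε : ℝ≥0∞}
    (hε : ε ≠ 0) :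
    ∃ δ, 0 < δ ∧ δ ≤ l ∧ ∀ S : Finset (Fin n), S.Nonempty →
      eLpNorm (tailKernel fun i => if i ∈ S then δ else l) p (volume.withDensity ω) ≤ ε := by
  have hq : 1 < p.toReal := by
    simpa using (ENNReal.toReal_lt_toReal ENNReal.one_ne_top hpt).2 hp
  have hq0 : 0 < p.toReal := by linarith
  have hq1 : 0 < p.toReal - 1 := by linarith
  obtain ⟨C, hC, h⟩ := exists_eLpNorm_tailKernel_bound hn hp hpt hA
  set K : ℝ≥0∞ := C / ε ^ p.toReal + 1 with hK
  have hεq : ε ^ p.toReal ≠ 0 := by simp [ENNReal.rpow_eq_zero_iff, hε, hq0.le]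
  have hKt : K ≠ ⊤ := ENNReal.add_ne_top.2 ⟨ENNReal.div_ne_top hC hεq, ENNReal.one_ne_top⟩
  have hK0 : K ≠ 0 := by simp [hK]
  choose L hL hML using fun j => hω.exists_le_dualMeasure hq hA j (inv_pos.2 hl)
    (ENNReal.rpow_ne_top_of_nonneg (inv_nonneg.2 hq1.le) hKt)
  obtain ⟨L', hL'⟩ : ∃ L', ∀ j, L j ≤ L' := (Finite.bddAbove_range L).imp fun b hb j =>
    hb (mem_range_self j)
  have hlL : l⁻¹ ≤ L' := (hL ⟨0, hn⟩).trans (hL' _)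
  have hL'0 : 0 < L' := (inv_pos.2 hl).trans_le hlL
  refine ⟨L'⁻¹, inv_pos.2 hL'0, inv_le_of_inv_le₀ hl hlL, fun S ⟨j, hj⟩ => ?_⟩
  set a : Fin n → ℝ := fun i => if i ∈ S then L'⁻¹ else l with ha
  have ha0 : ∀ i, 0 < a i := fun i => by
    simp only [ha]
    split_ifs
    · exact inv_pos.2 hL'0
    · exact hl
  have hdual : K ≤ dualMeasure p.toReal ω (symBox fun i => (a i)⁻¹) ^ (p.toReal - 1) := by
    rw [← ENNReal.rpow_inv_le_iff hq1]
    refine (hML j).trans (measure_mono (symBox_mono fun i => ?_))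
    by_cases hij : i = j
    · subst hij
      simpa [ha, hj] using hL' i
    · simp only [Function.update_of_ne hij, ha]
      split_ifs
      · simpa using hlL
      · exact le_rfl
  rw [← ENNReal.rpow_le_rpow_iff hq0]
  have h1 : eLpNorm (tailKernel a) p (volume.withDensity ω) ^ p.toReal * K ≤ C :=
    le_trans (by gcongr) (h a ha0)
  refine ((ENNReal.le_div_iff_mul_le (Or.inl hK0) (Or.inl hKt)).2 h1).trans ?_
  refine ENNReal.div_le_of_le_mul ?_
  by_cases htop : ε ^ p.toReal = ⊤
  · rw [htop, ENNReal.top_mul hK0]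
    exact le_top
  · rw [hK, mul_add, ENNReal.mul_div_cancel hεq htop]
    exact le_self_add

end Tails
end

noncomputable section

section Approximation

variable {n : ℕ} {X : Type*} [NormedAddCommGroup X] [NormedSpace ℂ X]

lemma continuous_integral_smul_sub {Q : Euc n → ℂ} (hQ : Integrable Q) {f : Euc n → X}
    (hf : Continuous f) (hfc : HasCompactSupport f) :
    Continuous fun x => ∫ t : Euc n, Q t • f (x - t) :=
  hfc.continuous_convolution_right (ContinuousLinearMap.lsmul ℂ ℂ) hQ.locallyIntegrable hf

lemma exists_symBox_of_hasCompactSupport {E : Type*} [NormedAddCommGroup E] {f : Euc n → E}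
    (hfc : HasCompactSupport f) :
    ∃ ρ, 0 ≤ ρ ∧ ∀ x, x ∉ symBox (fun _ : Fin n => ρ) → f x = 0 := by
  obtain ⟨ρ, hρ⟩ := hfc.isCompact.isBounded.exists_norm_le
  refine ⟨max ρ 0, le_max_right _ _, fun x hx => image_eq_zero_of_notMem_tsupport fun h => ?_⟩
  exact hx (mem_symBox.2 fun i => (PiLp.norm_apply_le x i).trans ((hρ x h).trans (le_max_left _ _)))

lemma integral_eq_one_of_fourier_zero {k : 𝓢(ℝ, ℂ)} (hk : 𝓕 (k : ℝ → ℂ) 0 = 1) :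
    ∫ t, k t = 1 := by
  rw [← hk, Real.fourier_real_eq]
  simp

lemma tendsto_integral_dilate_smul [CompleteSpace X] {k : 𝓢(ℝ, ℂ)} (hk : ∫ t, k t = 1) {f : Euc n → X} {M : ℝ}
    (hf : Continuous f) (hM : ∀ x, ‖f x‖ ≤ M) {l : ℕ → ℝ} (hl0 : ∀ m, 0 < l m)
    (hl : Tendsto l atTop atTop) (x : Euc n) :
    Tendsto (fun m => ∫ t : Euc n, (∏ i, dilate (l m) k (t i)) • f (x - t)) atTop (nhds (f x)) := by
  set K : Euc n → ℂ := fun z => ∏ i, k (z i) with hK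
  have hKi : Integrable K := integrable_tensor fun _ => k.integrable
  have hKc : Continuous K := by rw [hK]; fun_prop
  have hsub : ∀ m, ∫ t : Euc n, (∏ i, dilate (l m) k (t i)) • f (x - t)
      = ∫ z : Euc n, K z • f (x - (l m)⁻¹ • z) := by
    intro m
    have h := Measure.integral_comp_smul (volume : Measure (Euc n))
      (fun z => K z • f (x - (l m)⁻¹ • z)) (l m)
    have hpow : 0 < l m ^ n := pow_pos (hl0 m) n
    rw [finrank_euclideanSpace_fin, abs_of_pos (inv_pos.2 hpow), eq_inv_smul_iff₀ hpow.ne',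
      ← integral_smul] at h
    rw [← h]
    congr 1 with t
    rw [smul_smul, inv_mul_cancel₀ (hl0 m).ne', one_smul, ← Complex.coe_smul, smul_smul]
    congr 1
    simp only [dilate, hK, Finset.prod_mul_distrib, Finset.prod_const, Finset.card_univ,
      Fintype.card_fin, PiLp.smul_apply, smul_eq_mul, Complex.ofReal_pow]
  simp_rw [hsub]
  have hlim : ∫ z : Euc n, K z • f x = f x := by
    rw [integral_smul_const, hK, integral_tensor fun _ : Fin n => (k : ℝ → ℂ), hk]
    simp
  rw [← hlim]
  refine tendsto_integral_of_dominated_convergence (fun z => ‖K z‖ * M)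
    (fun m => Continuous.aestronglyMeasurable (by fun_prop)) (hKi.norm.mul_const M)
    (fun m => ae_of_all _ fun z => ?_) (ae_of_all _ fun z => ?_)
  · rw [norm_smul]
    gcongr
    exact hM _
  · have h : Tendsto (fun m => x - (l m)⁻¹ • z) atTop (nhds (x - (0 : ℝ) • z)) :=
      tendsto_const_nhds.sub ((tendsto_inv_atTop_zero.comp hl).smul_const z)
    rw [zero_smul, sub_zero] at h
    exact tendsto_const_nhds.smul ((hf.tendsto x).comp h)

lemma norm_prod_sub_sub_prod_le (a b : Fin n → ℂ) :
    ‖∏ i, (a i - b i) - ∏ i, a i‖ ≤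
      ∑ S ∈ Finset.univ.erase (∅ : Finset (Fin n)), ∏ i, ‖if i ∈ S then b i else a i‖ := by
  have h : ∏ i, (a i - b i) - ∏ i, a i = ∑ S ∈ Finset.univ.erase (∅ : Finset (Fin n)),
      ((-1) ^ S.card * ∏ i ∈ Finset.univ \ S, a i) * ∏ i ∈ S, b i := by
    rw [Finset.prod_sub, Finset.powerset_univ, ← Finset.add_sum_erase _ _ (Finset.mem_univ ∅)]
    simp
  rw [h]
  refine (norm_sum_le _ _).trans (Finset.sum_le_sum fun S _ => le_of_eq ?_)
  rw [← Finset.prod_sdiff (Finset.subset_univ S), norm_mul, norm_mul, norm_pow, norm_neg, norm_one,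
    one_pow, one_mul, norm_prod, norm_prod]
  congr 1
  · exact Finset.prod_congr rfl fun i hi => by rw [if_neg (Finset.mem_sdiff.1 hi).2]
  · exact Finset.prod_congr rfl fun i hi => by rw [if_pos hi]

lemma norm_integral_dilate_smul_le {k : 𝓢(ℝ, ℂ)} {f : Euc n → X} {M ρ : ℝ} (hρ : 0 ≤ ρ)
    (hM : ∀ x, ‖f x‖ ≤ M) (hf : ∀ x, x ∉ symBox (fun _ : Fin n => ρ) → f x = 0) :
    ∃ B, 0 ≤ B ∧ ∀ l, 1 ≤ l → ∀ x,
      ‖∫ t : Euc n, (∏ i, dilate l k (t i)) • f (x - t)‖ ≤ B * tailKernel (fun _ => 1) x := by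
  obtain ⟨B, hB0, hB⟩ := k.exists_dilate_bound_of_one_le (n + 1) hρ
  have hM0 : 0 ≤ M := (norm_nonneg _).trans (hM 0)
  refine ⟨M * B ^ n, by positivity, fun l hl x => ?_⟩
  refine (norm_integral_smul_le_of_tensor hM hf (Finset.univ : Finset Unit)
    (G := fun _ _ t => ‖dilate l k t‖) (B := fun _ _ t => B * ((1 + |t|) ^ (n + 1))⁻¹)
    (fun _ _ => (continuous_dilate l k.continuous).norm) (fun _ _ _ => norm_nonneg _)
    (fun t => by simp) (fun _ _ _ x => hB l hl x) x).trans_eq ?_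
  simp [tailKernel, Finset.prod_mul_distrib, mul_assoc]

lemma norm_integral_dilate_sub_dilate_smul_sub_le {k : 𝓢(ℝ, ℂ)} {f : Euc n → X} {M ρ l : ℝ}
    (hρ : 0 ≤ ρ) (hl : 0 < l) (hM : ∀ x, ‖f x‖ ≤ M)
    (hf : ∀ x, x ∉ symBox (fun _ : Fin n => ρ) → f x = 0) (hfc : Continuous f) :
    ∃ B, 0 ≤ B ∧ ∀ δ, 0 < δ → δ ≤ l → ∀ x,
      ‖(∫ t : Euc n, (∏ i, (dilate l k - dilate δ k) (t i)) • f (x - t))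
          - ∫ t : Euc n, (∏ i, dilate l k (t i)) • f (x - t)‖ ≤
        B * ∑ S ∈ Finset.univ.erase (∅ : Finset (Fin n)),
          tailKernel (fun i => if i ∈ S then δ else l) x := by
  obtain ⟨B, hB0, hB⟩ := k.exists_dilate_bound_of_le (n + 1) hρ hl.le
  have hM0 : 0 ≤ M := (norm_nonneg _).trans (hM 0)
  refine ⟨M * B ^ n, by positivity, fun δ hδ hδl x => ?_⟩
  have hκ : ∀ a, 0 < a → Integrable (dilate a k) := fun a ha => integrable_dilate ha.ne' k.integrable
  have hint : ∀ {κ : ℝ → ℂ}, Integrable κ →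
      Integrable fun t : Euc n => (∏ i, κ (t i)) • f (x - t) := fun hκ =>
    (integrable_tensor fun _ => hκ).smul_bdd M
      (Continuous.aestronglyMeasurable (by fun_prop)) (ae_of_all _ fun t => hM _)
  rw [← integral_sub (hint ((hκ l hl).sub (hκ δ hδ))) (hint (hκ l hl))]
  simp_rw [← sub_smul]
  set a : Finset (Fin n) → Fin n → ℝ := fun S i => if i ∈ S then δ else l with ha
  have ha0 : ∀ S i, 0 < a S i ∧ a S i ≤ l := fun S i => by
    simp only [ha]
    split_ifs
    · exact ⟨hδ, hδl⟩
    · exact ⟨hl, le_rfl⟩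
  refine (norm_integral_smul_le_of_tensor hM hf (Finset.univ.erase (∅ : Finset (Fin n)))
    (G := fun S i t => ‖dilate (a S i) k t‖)
    (B := fun S i t => B * (a S i * ((1 + a S i * |t|) ^ (n + 1))⁻¹))
    (fun S i => (continuous_dilate _ k.continuous).norm) (fun _ _ _ => norm_nonneg _)
    (fun t => ?_) (fun S _ i x => hB _ (ha0 S i).1 (ha0 S i).2 x) x).trans_eq ?_
  · refine (norm_prod_sub_sub_prod_le _ _).trans_eq ?_
    refine Finset.sum_congr rfl fun S _ => Finset.prod_congr rfl fun i _ => ?_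
    simp only [ha]
    split_ifs <;> rfl
  · simp only [tailKernel, Finset.prod_mul_distrib, Finset.prod_const, Finset.card_univ,
      Fintype.card_fin, ← Finset.mul_sum, mul_assoc]
    rfl

end Approximation
end

noncomputable section

section Density

variable {n : ℕ} {X : Type*} [NormedAddCommGroup X] [NormedSpace ℂ X] {ω : Euc n → ℝ≥0∞}
  {p : ℝ≥0∞}

lemma eLpNorm_tendsto_zero_of_dominated {α E : Type*} [MeasurableSpace α] [NormedAddCommGroup E]
    {μ : Measure α} (hp : p ≠ 0) (hpt : p ≠ ⊤) {F : ℕ → α → E} {g : α → ℝ}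
    (hF : ∀ m, AEStronglyMeasurable (F m) μ) (hg : MemLp g p μ) (hle : ∀ m x, ‖F m x‖ ≤ g x)
    (hlim : ∀ x, Tendsto (fun m => F m x) atTop (nhds 0)) :
    Tendsto (fun m => eLpNorm (F m) p μ) atTop (nhds 0) := by
  have hq : 0 < p.toReal := ENNReal.toReal_pos hp hpt
  have h : Tendsto (fun m => ∫⁻ x, ‖F m x‖ₑ ^ p.toReal ∂μ) atTop (nhds (∫⁻ _, 0 ∂μ)) := by
    refine tendsto_lintegral_of_dominated_convergence' (fun x => ‖g x‖ₑ ^ p.toReal)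
      (fun m => (hF m).enorm.pow_const _) (fun m => ae_of_all _ fun x => ?_)
      (lintegral_rpow_enorm_lt_top_of_eLpNorm_lt_top hp hpt hg.2).ne (ae_of_all _ fun x => ?_)
    · have : ‖F m x‖ₑ ≤ ‖g x‖ₑ := enorm_le_iff_norm_le.2 ((hle m x).trans (Real.le_norm_self _))
      exact ENNReal.rpow_le_rpow this hq.le
    · have h1 := (hlim x).enorm
      rw [enorm_zero] at h1
      simpa [hq] using h1.ennrpow_const p.toReal
  rw [lintegral_zero] at h
  simp_rw [eLpNorm_eq_lintegral_rpow_enorm_toReal hp hpt]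
  simpa [hq] using h.ennrpow_const (1 / p.toReal)

lemma IsWeight.isLocallyFiniteMeasure_withDensity (hω : IsWeight ω) :
    IsLocallyFiniteMeasure (volume.withDensity ω) := by
  refine ⟨fun x => ⟨Metric.closedBall x 1, Metric.closedBall_mem_nhds x one_pos, ?_⟩⟩
  rw [withDensity_apply _ measurableSet_closedBall]
  exact lt_top_iff_ne_top.2 (hω.2.2 _ (isCompact_closedBall x 1))

/-- Compactly supported continuous functions are approximated in the weighted space by their
convolutions with differences of dilated cutoff kernels. -/
lemma IsWeight.exists_fourierInv_eLpNorm_sub_le [CompleteSpace X] (hω : IsWeight ω) (hn : 1 ≤ n)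
    (hp : 1 < p) (hpt : p ≠ ⊤) (hA : rectApChar n p.toReal ω ω ≠ ⊤) {f : Euc n → X}
    (hf : Continuous f) (hfc : HasCompactSupport f) {ε : ℝ≥0∞} (hε : ε ≠ 0) :
    ∃ g : Euc n → X, ContDiff ℝ (⊤ : ℕ∞) g ∧ HasCompactSupport g ∧
      tsupport g ⊆ {ξ : Euc n | ∀ i, ξ i ≠ 0} ∧
      AEStronglyMeasurable (𝓕⁻ g) (volume.withDensity ω) ∧
      eLpNorm (𝓕⁻ g - f) p (volume.withDensity ω) ≤ ε := by
  set μ := volume.withDensity ω with hμ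
  obtain ⟨k, hk1, hk0⟩ := exists_fourier_cutoff
  have hk : ∫ t, k t = 1 := integral_eq_one_of_fourier_zero (hk1 0 (by simp))
  obtain ⟨ρ, hρ, hfρ⟩ := exists_symBox_of_hasCompactSupport hfc
  obtain ⟨M, hM⟩ := hfc.exists_bound_of_continuous hf
  have hconv : ∀ {κ : ℝ → ℂ}, Integrable κ → AEStronglyMeasurable
      (fun x => ∫ t : Euc n, (∏ i, κ (t i)) • f (x - t)) μ := fun hκ =>
    (continuous_integral_smul_sub (integrable_tensor fun _ => hκ) hf hfc).aestronglyMeasurable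
  have hdil : ∀ a, 0 < a → Integrable (dilate a k) :=
    fun a ha => integrable_dilate ha.ne' k.integrable
  have hε2 : ε / 2 ≠ 0 := by simp [hε]
  obtain ⟨l, hl1, hl⟩ : ∃ l : ℝ, 1 ≤ l ∧
      eLpNorm ((fun x => ∫ t : Euc n, (∏ i, dilate l k (t i)) • f (x - t)) - f) p μ ≤ ε / 2 := by
    obtain ⟨B, -, hB⟩ := norm_integral_dilate_smul_le (k := k) hρ hM hfρ
    have hl1 : ∀ m : ℕ, (1 : ℝ) ≤ m + 1 := fun m => by simp
    have hlim := tendsto_integral_dilate_smul hk hf hM (l := fun m : ℕ => (m : ℝ) + 1)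
      (fun m => by positivity) (tendsto_atTop_add_const_right _ _ tendsto_natCast_atTop_atTop)
    have hfB : ∀ x, ‖f x‖ ≤ B * tailKernel (fun _ => 1) x := fun x =>
      le_of_tendsto (hlim x).norm (Eventually.of_forall fun m => hB _ (hl1 m) x)
    have h := eLpNorm_tendsto_zero_of_dominated (μ := μ) (zero_lt_one.trans hp).ne' hpt
      (F := fun m : ℕ => (fun x => ∫ t : Euc n, (∏ i, dilate (m + 1) k (t i)) • f (x - t)) - f)
      (g := fun x => (B + B) * tailKernel (fun _ => 1) x)
      (fun m => (hconv (hdil _ (by positivity))).sub hf.aestronglyMeasurable)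
      ((hω.memLp_tailKernel hn hp hpt hA fun _ => one_pos).const_mul _)
      (fun m x => (norm_sub_le _ _).trans <| by
        rw [add_mul]
        exact add_le_add (hB _ (hl1 m) x) (hfB x))
      (fun x => by simpa using (hlim x).sub_const (f x))
    obtain ⟨m, hm⟩ := (h.eventually_le_const (pos_iff_ne_zero.2 hε2)).exists
    exact ⟨m + 1, hl1 m, hm⟩
  have hl0 : 0 < l := by linarith
  obtain ⟨B, hB0, hB⟩ :=
    norm_integral_dilate_sub_dilate_smul_sub_le (k := k) hρ hl0 hM hfρ hf
  set N : ℝ≥0∞ := ENNReal.ofReal B * (Finset.univ.erase (∅ : Finset (Fin n))).card with hN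
  have hNt : N ≠ ⊤ := ENNReal.mul_ne_top ENNReal.ofReal_ne_top (ENNReal.natCast_ne_top _)
  obtain ⟨δ, hδ, hδl, hδε⟩ := hω.exists_eLpNorm_tailKernel_le hn hp hpt hA hl0
    (ε := ε / 2 / N) (ENNReal.div_ne_zero.2 ⟨hε2, hNt⟩)
  obtain ⟨g, hg, hgc, hgs, hgF⟩ := exists_fourierInv_eq hk1 hk0 hδ hδl hf hfc
  refine ⟨g, hg, hgc, hgs, ?_⟩
  rw [hgF]
  have hmeas := hconv ((hdil l hl0).sub (hdil δ hδ))
  refine ⟨hmeas, ?_⟩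
  set h := fun x => ∫ t : Euc n, (∏ i, (dilate l k - dilate δ k) (t i)) • f (x - t)
  set u := fun x => ∫ t : Euc n, (∏ i, dilate l k (t i)) • f (x - t)
  have hu : AEStronglyMeasurable u μ := hconv (hdil l hl0)
  have hpos : ∀ S : Finset (Fin n), ∀ i, 0 < if i ∈ S then δ else l := fun S i => by
    split_ifs <;> assumption
  have hhu : eLpNorm (h - u) p μ ≤ ε / 2 := by
    calc eLpNorm (h - u) p μ
        ≤ ENNReal.ofReal B * eLpNorm (∑ S ∈ Finset.univ.erase (∅ : Finset (Fin n)),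
            tailKernel fun i => if i ∈ S then δ else l) p μ := by
          refine eLpNorm_le_mul_eLpNorm_of_ae_le_mul (ae_of_all _ fun x => ?_) p
          rw [Finset.sum_apply, Real.norm_of_nonneg
            (Finset.sum_nonneg fun S _ => tailKernel_nonneg (hpos S) x)]
          exact hB δ hδ hδl x
      _ ≤ ENNReal.ofReal B * ∑ S ∈ Finset.univ.erase (∅ : Finset (Fin n)), ε / 2 / N := by
          gcongr
          refine (eLpNorm_sum_le (fun S _ => (measurable_tailKernel _).aestronglyMeasurable)
            hp.le).trans (Finset.sum_le_sum fun S hS => hδε S ?_)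
          exact Finset.nonempty_iff_ne_empty.2 (Finset.ne_of_mem_erase hS)
      _ = N * (ε / 2 / N) := by
          rw [Finset.sum_const, nsmul_eq_mul, hN, mul_assoc]
      _ ≤ ε / 2 := ENNReal.mul_div_le
  calc eLpNorm (h - f) p μ = eLpNorm ((h - u) + (u - f)) p μ := by rw [sub_add_sub_cancel]
    _ ≤ eLpNorm (h - u) p μ + eLpNorm (u - f) p μ :=
        eLpNorm_add_le (hmeas.sub hu) (hu.sub hf.aestronglyMeasurable) hp.le
    _ ≤ ε / 2 + ε / 2 := add_le_add hhu hl
    _ = ε := ENNReal.add_halves ε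

end Density
end

noncomputable section

/-- Density of inverse Fourier transforms of smooth functions
compactly supported in `ℝ^n_* = (ℝ \ {0})^n` in the weighted space `L^p_ω(ℝ^n;X)`
for `ω ∈ A_p(ℝ^n;𝓡_n)`. -/
theorem density_inv_fourier_compact_support
    {X : Type*} [NormedAddCommGroup X] [NormedSpace ℂ X] [CompleteSpace X]
    (n : ℕ) (hn : 1 ≤ n) (p : ℝ≥0∞) [Fact (1 ≤ p)] (hp : 1 < p) (hpt : p ≠ ⊤)
    (ω : Euc n → ℝ≥0∞) (hω : IsWeight ω) (hωA : rectApChar n p.toReal ω ω ≠ ⊤) :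
    Dense {F : Lp X p (volume.withDensity ω) |
      ∃ g : Euc n → X, ContDiff ℝ (⊤ : ℕ∞) g ∧ HasCompactSupport g ∧
        tsupport g ⊆ {ξ : Euc n | ∀ i, ξ i ≠ 0} ∧
        ∀ᵐ x ∂(volume.withDensity ω), F x = 𝓕⁻ g x} := by
  have := hω.isLocallyFiniteMeasure_withDensity
  intro F
  refine Metric.mem_closure_iff.2 fun ε hε => ?_
  have hε4 : ENNReal.ofReal (ε / 4) ≠ 0 := by simpa using hε
  obtain ⟨f, hfc, hFf, hf, hfp⟩ :=
    (Lp.memLp F).exists_hasCompactSupport_eLpNorm_sub_le hpt hε4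
  obtain ⟨g, hg, hgc, hgs, hgm, hgf⟩ :=
    hω.exists_fourierInv_eLpNorm_sub_le hn hp hpt hωA hf hfc hε4
  have hdiff : MemLp (𝓕⁻ g - f) p (volume.withDensity ω) :=
    ⟨hgm.sub hf.aestronglyMeasurable, hgf.trans_lt ENNReal.ofReal_lt_top⟩
  have hgp : MemLp (𝓕⁻ g) p (volume.withDensity ω) := by simpa using hdiff.add hfp
  refine ⟨hgp.toLp, ⟨g, hg, hgc, hgs, hgp.coeFn_toLp⟩, ?_⟩
  rw [← edist_lt_ofReal, Lp.edist_def,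
    eLpNorm_congr_ae ((EventuallyEq.refl _ F).sub hgp.coeFn_toLp)]
  calc eLpNorm (⇑F - 𝓕⁻ g) p (volume.withDensity ω)
      = eLpNorm ((⇑F - f) - (𝓕⁻ g - f)) p (volume.withDensity ω) := by
        rw [sub_sub_sub_cancel_right]
    _ ≤ ENNReal.ofReal (ε / 4) + ENNReal.ofReal (ε / 4) :=
        (eLpNorm_sub_le ((Lp.aestronglyMeasurable F).sub hf.aestronglyMeasurable)
          hdiff.aestronglyMeasurable hp.le).trans (add_le_add hFf hgf)
    _ < ENNReal.ofReal ε := by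
        rw [← ENNReal.ofReal_add (by positivity) (by positivity)]
        exact (ENNReal.ofReal_lt_ofReal_iff hε).2 (by linarith)

end
end

section
/- Let X be a Banach space such that both X and its dual X* have Pisier's property (α), and let Δ^j = (Δ^j_{i_j})_{i_j ∈ I_j}, j = 1,…,n, be unconditional decompositions of X that commute (any projection from any family commutes with any projection from any other family). Put I := I_1 × ⋯ × I_n and, for i = (i_1,…,i_n) ∈ I, Δ_i := Δ^1_{i_1}⋯Δ^n_{i_n}. Then Δ = (Δ_i)_{i∈I} is an unconditional decomposition of X with C⁺_Δ ≤ α_X^{n−1}·C⁺_{Δ^1}⋯C⁺_{Δ^n} and C⁻_Δ ≤ C⁺_{Δ*} ≤ α_{X*}^{n−1}·C⁺_{(Δ^1)*}⋯C⁺_{(Δ^n)*}, where Δ* and (Δ^j)* denote the adjoint families on X*. -/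
open MeasureTheory Filter Set
open scoped ENNReal NNReal SchwartzMap FourierTransform

noncomputable section

lemma rsign_mul_self (b : Bool) : rsign b * rsign b = 1 := by
  cases b <;> simp [rsign]

lemma rsign_beq (a b : Bool) : rsign (a == b) = rsign a * rsign b := by
  cases a <;> cases b <;> simp [rsign]

lemma abs_rsign (b : Bool) : |rsign b| = 1 := by
  cases b <;> simp [rsign]

/-- A sum over the rectangle spanned by a finite set `F` of a function vanishing outside `F`. -/
lemma sum_rectangle {ι ι' X : Type*} [DecidableEq ι] [DecidableEq ι'] [AddCommMonoid X]
    {F : Finset (ι × ι')} {f : ι × ι' → X} (hf : ∀ k, k ∉ F → f k = 0) :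
    ∑ i : {i // i ∈ F.image Prod.fst}, ∑ j : {j // j ∈ F.image Prod.snd}, f (i.1, j.1) =
      ∑ k ∈ F, f k := by
  rw [Finset.sum_coe_sort (F.image Prod.fst) fun i =>
    ∑ j : {j // j ∈ F.image Prod.snd}, f (i, j.1)]
  rw [Finset.sum_congr rfl fun i _ => Finset.sum_coe_sort (F.image Prod.snd) fun j => f (i, j)]
  rw [← Finset.sum_product']
  symm
  refine Finset.sum_subset (fun k hk => ?_) fun k _ hk => hf k hk
  exact Finset.mem_product.2 ⟨Finset.mem_image_of_mem _ hk, Finset.mem_image_of_mem _ hk⟩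

section Signs

variable {X : Type*} [NormedAddCommGroup X] [NormedSpace ℂ X]

/-- Property `(α)` for matrices indexed by arbitrary finite types. -/
lemma HasPisierAlphaWith.fintype {C : ℝ} (h : HasPisierAlphaWith X C)
    {κ κ' : Type*} [Fintype κ] [DecidableEq κ] [Fintype κ'] [DecidableEq κ']
    (a : κ → κ' → ℂ) (x : κ → κ' → X) (ha : ∀ i j, ‖a i j‖ ≤ 1) :
    ∑ ε : κ → Bool, ∑ δ : κ' → Bool,
        ‖∑ i, ∑ j, (rsign (ε i) * rsign (δ j)) • (a i j • x i j)‖ ^ 2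
      ≤ C ^ 2 * ∑ ε : κ → Bool, ∑ δ : κ' → Bool,
          ‖∑ i, ∑ j, (rsign (ε i) * rsign (δ j)) • x i j‖ ^ 2 := by
  set e := Fintype.equivFin κ
  set e' := Fintype.equivFin κ'
  have key : ∀ y : κ → κ' → X,
      ∑ ε : Fin (Fintype.card κ) → Bool, ∑ δ : Fin (Fintype.card κ') → Bool,
        ‖∑ i, ∑ j, (rsign (ε i) * rsign (δ j)) • y (e.symm i) (e'.symm j)‖ ^ 2 =
      ∑ ε : κ → Bool, ∑ δ : κ' → Bool,
        ‖∑ i, ∑ j, (rsign (ε i) * rsign (δ j)) • y i j‖ ^ 2 := by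
    intro y
    refine Fintype.sum_equiv (e.arrowCongr (Equiv.refl Bool)).symm _ _ fun ε => ?_
    refine Fintype.sum_equiv (e'.arrowCongr (Equiv.refl Bool)).symm _ _ fun δ => ?_
    congr 2
    refine Fintype.sum_equiv e.symm _ _ fun i => ?_
    refine Fintype.sum_equiv e'.symm _ _ fun j => ?_
    simp [Equiv.arrowCongr]
  have := h.2 _ _ (fun i j => a (e.symm i) (e'.symm j)) (fun i j => x (e.symm i) (e'.symm j))
    (fun i j => ha _ _)
  rw [key x, key fun i j => a i j • x i j] at this
  exact this

variable {ι : Type*}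

/-- The property `U⁺` tested on families of indices given by an injection of a finite type. -/
lemma UPlusWith.of_injective [DecidableEq ι] {Δ : ι → (X →L[ℂ] X)} {C : ℝ}
    (h : UPlusWith Δ C) {κ : Type*} [Fintype κ] [DecidableEq κ] {e : κ → ι}
    (he : Function.Injective e) (x : X) :
    ∑ ε : κ → Bool, ‖∑ k, rsign (ε k) • Δ (e k) x‖ ^ 2
      ≤ 2 ^ Fintype.card κ * (C ^ 2 * ‖∑ k, Δ (e k) x‖ ^ 2) := by
  classical
  have := h (Finset.univ.image e) x
  rw [Finset.card_image_of_injective _ he, Finset.card_univ,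
    Finset.sum_image he.injOn] at this
  refine le_of_eq_of_le ?_ this
  let g : κ ≃ {i // i ∈ Finset.univ.image e} :=
    Equiv.ofBijective (fun k => ⟨e k, by simp⟩) ⟨fun a b hab => he (by simpa using hab), by
      rintro ⟨i, hi⟩
      obtain ⟨k, -, rfl⟩ := Finset.mem_image.1 hi
      exact ⟨k, rfl⟩⟩
  refine Fintype.sum_equiv (g.arrowCongr (Equiv.refl Bool)) _ _ fun ε => ?_
  congr 2
  refine Fintype.sum_equiv g _ _ fun i => ?_
  simp only [Equiv.arrowCongr_apply, Equiv.coe_refl, Function.comp_apply,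
    Equiv.symm_apply_apply, id_eq]
  rfl

lemma UPlusWith.comp_injective {ι' : Type*} [DecidableEq ι] [DecidableEq ι']
    {Δ : ι → (X →L[ℂ] X)} {C : ℝ}
    (h : UPlusWith Δ C) {e : ι' → ι} (he : Function.Injective e) :
    UPlusWith (fun i => Δ (e i)) C := by
  intro F x
  have := h.of_injective (he.comp (Subtype.val_injective (p := fun i => i ∈ F))) x
  simp only [Function.comp_apply] at this
  rw [Fintype.card_coe, Finset.sum_coe_sort F fun i => Δ (e i) x] at this
  exact this

lemma IsPreDecomp.comp_injective {ι' : Type*} {Δ : ι → (X →L[ℂ] X)}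
    (h : IsPreDecomp Δ) {e : ι' → ι} (he : Function.Injective e) :
    IsPreDecomp (fun i => Δ (e i)) :=
  ⟨fun _ => h.1 _, fun _ _ hij => h.2 _ _ (he.ne hij)⟩

lemma IsUncondDecomp.comp_equiv {ι' : Type*} {Δ : ι → (X →L[ℂ] X)}
    (h : IsUncondDecomp Δ) (e : ι' ≃ ι) : IsUncondDecomp (fun i => Δ (e i)) :=
  ⟨h.1.comp_injective e.injective, fun x => e.hasSum_iff.2 (h.2 x)⟩

lemma IsPreDecomp.apply_apply [DecidableEq ι] {Δ : ι → (X →L[ℂ] X)} (h : IsPreDecomp Δ)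
    (i j : ι) (x : X) : Δ i (Δ j x) = if i = j then Δ i x else 0 := by
  split_ifs with hij
  · rw [← hij, h.1]
  · exact h.2 i j hij x

/-- A product of two commuting pre-decompositions is a pre-decomposition. -/
lemma IsPreDecomp.prod {ι' : Type*} {A : ι → (X →L[ℂ] X)} {B : ι' → (X →L[ℂ] X)}
    (hA : IsPreDecomp A) (hB : IsPreDecomp B)
    (hAB : ∀ i j x, A i (B j x) = B j (A i x)) :
    IsPreDecomp (fun k : ι × ι' => (A k.1).comp (B k.2)) := by
  refine ⟨fun k x => ?_, fun k l hkl x => ?_⟩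
  · simp only [ContinuousLinearMap.comp_apply]
    rw [← hAB k.1 k.2 (B k.2 x), hA.1, hB.1]
  · simp only [ContinuousLinearMap.comp_apply]
    by_cases h1 : k.1 = l.1
    · have h2 : k.2 ≠ l.2 := fun h2 => hkl (Prod.ext h1 h2)
      rw [hAB l.1, hB.2 _ _ h2, map_zero]
    · rw [← hAB l.1, hA.2 _ _ h1]

/-- A product of two commuting pre-decompositions with `U⁺` has `U⁺`, under property `(α)`. -/
lemma UPlusWith.prod {ι' : Type*} [DecidableEq ι] [DecidableEq ι']
    {A : ι → (X →L[ℂ] X)} {B : ι' → (X →L[ℂ] X)} {a CA CB : ℝ}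
    (ha : HasPisierAlphaWith X a) (hA : IsPreDecomp A) (hB : IsPreDecomp B)
    (hAB : ∀ i j x, A i (B j x) = B j (A i x))
    (uA : UPlusWith A CA) (uB : UPlusWith B CB) :
    UPlusWith (fun k : ι × ι' => (A k.1).comp (B k.2)) (a * (CA * CB)) := by
  intro F x
  set P : ι × ι' → (X →L[ℂ] X) := fun k => (A k.1).comp (B k.2) with hP
  set y := ∑ k ∈ F, P k x with hy
  have hPP : ∀ k l z, P k (P l z) = if k = l then P k z else 0 :=
    (hA.prod hB hAB).apply_apply
  have hPy : ∀ k, P k y = if k ∈ F then P k x else 0 := by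
    intro k
    simp only [hy, map_sum]
    rw [Finset.sum_congr rfl fun l _ => hPP k l x]
    simp
  let κ := {i // i ∈ F.image Prod.fst}
  let κ' := {j // j ∈ F.image Prod.snd}
  have hrect : ∀ f : ι × ι' → X, (∀ k, k ∉ F → f k = 0) →
      ∑ i : κ, ∑ j : κ', f (i.1, j.1) = ∑ k ∈ F, f k := fun f => sum_rectangle
  have hyy : ∑ i : κ, ∑ j : κ', P (i.1, j.1) y = y := by
    rw [hrect (fun k => P k y) fun k hk => by simp [hPy, hk], hy]
    exact Finset.sum_congr rfl fun k hk => by rw [← hy, hPy, if_pos hk]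
  -- the double Rademacher average
  have h2 : ∑ ε : κ → Bool, ∑ δ : κ' → Bool,
      ‖∑ i, ∑ j, (rsign (ε i) * rsign (δ j)) • P (i.1, j.1) y‖ ^ 2 ≤
      2 ^ Fintype.card κ * 2 ^ Fintype.card κ' * ((CA * CB) ^ 2 * ‖y‖ ^ 2) := by
    rw [Finset.sum_comm]
    calc _ ≤ ∑ δ : κ' → Bool, 2 ^ Fintype.card κ * (CA ^ 2 *
          ‖∑ j : κ', rsign (δ j) • B j.1 (∑ i : κ, A i.1 y)‖ ^ 2) := by
          refine Finset.sum_le_sum fun δ _ => ?_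
          have e₁ : ∀ ε : κ → Bool, ∑ i, ∑ j, (rsign (ε i) * rsign (δ j)) • P (i.1, j.1) y =
              ∑ i, rsign (ε i) • A i.1 (∑ j : κ', rsign (δ j) • B j.1 y) := fun ε => by
            simp [hP, Finset.smul_sum, mul_smul, ContinuousLinearMap.map_smul_of_tower]
          have e₂ : ∑ j : κ', rsign (δ j) • B j.1 (∑ i : κ, A i.1 y) =
              ∑ i : κ, A i.1 (∑ j : κ', rsign (δ j) • B j.1 y) := by
            simp only [map_sum, Finset.smul_sum]
            rw [Finset.sum_comm]
            simp [hAB, ContinuousLinearMap.map_smul_of_tower]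
          simp only [e₁, e₂]
          exact uA.of_injective Subtype.val_injective _
      _ ≤ 2 ^ Fintype.card κ * (CA ^ 2 * (2 ^ Fintype.card κ' * (CB ^ 2 *
          ‖∑ j : κ', B j.1 (∑ i : κ, A i.1 y)‖ ^ 2))) := by
          rw [← Finset.mul_sum, ← Finset.mul_sum]
          gcongr
          exact uB.of_injective Subtype.val_injective _
      _ = _ := by
          have : ∑ j : κ', B j.1 (∑ i : κ, A i.1 y) = y := by
            conv_rhs => rw [← hyy]
            rw [Finset.sum_comm]
            simp [hP, hAB]
          rw [this]; ring
  -- property `(α)` with a fixed choice of signs on `F`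
  have h3 : ∀ η : {k // k ∈ F} → Bool, ∑ ε : κ → Bool, ∑ δ : κ' → Bool,
      ‖∑ k : {k // k ∈ F}, (rsign (η k) * (rsign (ε ⟨k.1.1, Finset.mem_image_of_mem _ k.2⟩) *
        rsign (δ ⟨k.1.2, Finset.mem_image_of_mem _ k.2⟩))) • P k.1 x‖ ^ 2 ≤
      a ^ 2 * (2 ^ Fintype.card κ * 2 ^ Fintype.card κ' * ((CA * CB) ^ 2 * ‖y‖ ^ 2)) := by
    intro η
    have := ha.fintype (κ := κ) (κ' := κ')
      (fun i j => if h : (i.1, j.1) ∈ F then ((rsign (η ⟨_, h⟩) : ℝ) : ℂ) else 0)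
      (fun i j => P (i.1, j.1) y) (fun i j => by
        split_ifs
        · simp [abs_rsign]
        · simp)
    refine le_trans (le_of_eq ?_) (this.trans (by gcongr))
    refine Finset.sum_congr rfl fun ε _ => Finset.sum_congr rfl fun δ _ => ?_
    congr 2
    have h4 := hrect (fun k => if h : k ∈ F then
      (rsign (η ⟨k, h⟩) * (rsign (ε ⟨k.1, Finset.mem_image_of_mem _ h⟩) *
        rsign (δ ⟨k.2, Finset.mem_image_of_mem _ h⟩))) • P k x else 0)
      (fun k hk => by simp [hk])
    rw [← Finset.sum_coe_sort F] at h4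
    simp only [Finset.coe_mem, dif_pos] at h4
    rw [← h4]
    refine Finset.sum_congr rfl fun i _ => Finset.sum_congr rfl fun j _ => ?_
    split_ifs with h
    · rw [hPy, if_pos h, Complex.coe_smul, smul_smul]
      congr 1; ring
    · simp
  have h5 := Finset.sum_le_sum fun (η : {k // k ∈ F} → Bool) (_ : η ∈ Finset.univ) => h3 η
  rw [Finset.sum_comm] at h5
  have h6 : ∀ (ε : κ → Bool), (∑ η : {k // k ∈ F} → Bool, ∑ δ : κ' → Bool,
      ‖∑ k : {k // k ∈ F}, (rsign (η k) * (rsign (ε ⟨k.1.1, Finset.mem_image_of_mem _ k.2⟩) *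
        rsign (δ ⟨k.1.2, Finset.mem_image_of_mem _ k.2⟩))) • P k.1 x‖ ^ 2) =
      2 ^ Fintype.card κ' *
        ∑ η : {k // k ∈ F} → Bool, ‖∑ k : {k // k ∈ F}, rsign (η k) • P k.1 x‖ ^ 2 := by
    intro ε
    rw [Finset.sum_comm]
    rw [Finset.sum_congr rfl (g := fun _ => ∑ η : {k // k ∈ F} → Bool,
      ‖∑ k : {k // k ∈ F}, rsign (η k) • P k.1 x‖ ^ 2)]
    · simp
    intro δ _
    have hinv : Function.Involutive fun (η : {k // k ∈ F} → Bool) k =>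
        (η k == (ε ⟨k.1.1, Finset.mem_image_of_mem _ k.2⟩ ==
          δ ⟨k.1.2, Finset.mem_image_of_mem _ k.2⟩)) := by
      intro η
      funext k
      dsimp only
      generalize (ε _ == δ _) = b
      cases η k <;> cases b <;> rfl
    refine Fintype.sum_equiv hinv.toPerm _ _ fun η => ?_
    simp [Function.Involutive.toPerm, rsign_beq]
  simp only [h6] at h5
  simp only [Finset.sum_const, Finset.card_univ, Fintype.card_fun, Fintype.card_bool,
    nsmul_eq_mul, Fintype.card_coe F, Nat.cast_pow, Nat.cast_ofNat] at h5
  have hpos : (0 : ℝ) < 2 ^ Fintype.card κ * 2 ^ Fintype.card κ' := by positivity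
  refine le_of_mul_le_mul_left ?_ hpos
  refine le_trans (le_of_eq ?_) (h5.trans (le_of_eq ?_)) <;> ring

end Signs

section Unconditional

variable {X : Type*} [NormedAddCommGroup X] [NormedSpace ℂ X] {ι : Type*}

/-- The partial sums of an unconditional decomposition are uniformly bounded. -/
lemma IsUncondDecomp.exists_bound [CompleteSpace X] {Δ : ι → (X →L[ℂ] X)}
    (h : IsUncondDecomp Δ) :
    ∃ M : ℝ, 0 < M ∧ ∀ (F : Finset ι) (x : X), ‖∑ i ∈ F, Δ i x‖ ≤ M * ‖x‖ := by
  classical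
  obtain ⟨M, hM⟩ := banach_steinhaus (g := fun F : Finset ι => ∑ i ∈ F, Δ i) (by
    intro x
    obtain ⟨s, hs⟩ := summable_iff_vanishing_norm.1 (h.2 x).summable 1 one_pos
    refine ⟨∑ i ∈ s, ‖Δ i x‖ + 1, fun F => ?_⟩
    rw [_root_.sum_apply, ← Finset.sum_inter_add_sum_sdiff F s]
    refine (norm_add_le _ _).trans (add_le_add ?_ (hs _ Finset.sdiff_disjoint).le)
    refine (norm_sum_le _ _).trans ?_
    exact Finset.sum_le_sum_of_subset_of_nonneg Finset.inter_subset_right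
      fun _ _ _ => norm_nonneg _)
  refine ⟨max M 1, by positivity, fun F x => ?_⟩
  rw [← _root_.sum_apply]
  exact ContinuousLinearMap.le_of_opNorm_le _ ((hM F).trans (le_max_left _ _)) x

lemma norm_sum_rsign_smul_le {Δ : ι → (X →L[ℂ] X)} {M : ℝ}
    (hM : ∀ (F : Finset ι) (x : X), ‖∑ i ∈ F, Δ i x‖ ≤ M * ‖x‖)
    {κ : Type*} [Fintype κ] {e : κ → ι} (he : Function.Injective e) (ε : κ → Bool) (x : X) :
    ‖∑ k, rsign (ε k) • Δ (e k) x‖ ≤ 2 * M * ‖x‖ := by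
  classical
  have h : ∀ S : Finset κ, ‖∑ k ∈ S, Δ (e k) x‖ ≤ M * ‖x‖ := fun S => by
    simpa [Finset.sum_map] using hM (S.map ⟨e, he⟩) x
  rw [← Finset.sum_filter_add_sum_filter_not Finset.univ (fun k => ε k = true)]
  refine (norm_add_le _ _).trans ?_
  rw [two_mul, add_mul]
  refine add_le_add (le_of_eq_of_le ?_ (h (Finset.univ.filter fun k => ε k = true)))
    (le_of_eq_of_le ?_ (h (Finset.univ.filter fun k => ¬ ε k = true)))
  · congr 1
    refine Finset.sum_congr rfl fun k hk => ?_
    simp [rsign, (Finset.mem_filter.1 hk).2]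
  · rw [← norm_neg, ← Finset.sum_neg_distrib]
    congr 1
    refine Finset.sum_congr rfl fun k hk => ?_
    simp [rsign, (Finset.mem_filter.1 hk).2]

/-- Signed sums of a pre-decomposition act diagonally. -/
lemma IsPreDecomp.sum_rsign_smul_apply {Δ : ι → (X →L[ℂ] X)} (h : IsPreDecomp Δ)
    {κ : Type*} [Fintype κ] {e : κ → ι} (he : Function.Injective e) (ε : κ → Bool)
    (k : κ) (x : X) :
    ∑ l, rsign (ε l) • Δ (e l) (Δ (e k) x) = rsign (ε k) • Δ (e k) x := by
  rw [Finset.sum_eq_single k (fun l _ hl => by rw [h.2 _ _ (he.ne hl), smul_zero]) (by simp),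
    h.1]

/-- A pre-decomposition with uniformly bounded partial sums and dense span is an unconditional
decomposition. -/
lemma IsPreDecomp.isUncondDecomp {Δ : ι → (X →L[ℂ] X)} (h : IsPreDecomp Δ) {K : ℝ}
    (hK : 0 ≤ K) (hb : ∀ (F : Finset ι) (x : X), ‖∑ i ∈ F, Δ i x‖ ≤ K * ‖x‖)
    (hd : ∀ x : X, ∀ r > 0, ∃ (R : Finset ι) (u : X), ‖∑ i ∈ R, Δ i u - x‖ < r) :
    IsUncondDecomp Δ := by
  classical
  refine ⟨h, fun x => ?_⟩
  rw [HasSum, SummationFilter.unconditional_filter, Metric.tendsto_atTop]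
  intro r hr
  obtain ⟨R, u, hu⟩ := hd x (r / (K + 1)) (by positivity)
  refine ⟨R, fun F hF => ?_⟩
  set z := ∑ i ∈ R, Δ i u with hz
  have hFz : ∑ i ∈ F, Δ i z = z := by
    simp only [hz, map_sum, h.apply_apply]
    rw [Finset.sum_comm]
    refine Finset.sum_congr rfl fun i hi => ?_
    simp [hF hi]
  have : ∑ i ∈ F, Δ i x - x = (z - x) - ∑ i ∈ F, Δ i (z - x) := by
    simp only [map_sub, Finset.sum_sub_distrib, hFz]
    abel
  rw [dist_eq_norm, this]
  calc _ ≤ ‖z - x‖ + K * ‖z - x‖ := (norm_sub_le _ _).trans (add_le_add_right (hb _ _) _)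
    _ = ‖z - x‖ * (K + 1) := by ring
    _ < r := by rwa [← lt_div_iff₀ (by positivity)]

/-- Under property `(α)`, the product of two commuting unconditional decompositions is an
unconditional decomposition. -/
lemma IsUncondDecomp.prod [CompleteSpace X] {ι' : Type*} {A : ι → (X →L[ℂ] X)}
    {B : ι' → (X →L[ℂ] X)} {a : ℝ} (ha : HasPisierAlphaWith X a)
    (hA : IsUncondDecomp A) (hB : IsUncondDecomp B)
    (hAB : ∀ i j x, A i (B j x) = B j (A i x)) :
    IsUncondDecomp (fun k : ι × ι' => (A k.1).comp (B k.2)) := by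
  classical
  obtain ⟨MA, hMA, bA⟩ := hA.exists_bound
  obtain ⟨MB, hMB, bB⟩ := hB.exists_bound
  have ha0 := ha.1
  refine (hA.1.prod hB.1 hAB).isUncondDecomp (K := (2 * MA * (2 * MB)) ^ 2 * a)
    (by positivity) (fun F x => ?_) fun x r hr => ?_
  · let κ := {i // i ∈ F.image Prod.fst}
    let κ' := {j // j ∈ F.image Prod.snd}
    set K := 2 * MA * (2 * MB) with hK
    have hK0 : 0 < K := by positivity
    have iA : Function.Injective (Subtype.val : κ → ι) := Subtype.val_injective
    have iB : Function.Injective (Subtype.val : κ' → ι') := Subtype.val_injective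
    let S : (κ → Bool) → (κ' → Bool) → (X →L[ℂ] X) := fun ε δ =>
      (∑ i : κ, ((rsign (ε i) : ℝ) : ℂ) • A i.1).comp
        (∑ j : κ', ((rsign (δ j) : ℝ) : ℂ) • B j.1)
    have hSa : ∀ ε δ z, S ε δ z =
        ∑ i : κ, rsign (ε i) • A i.1 (∑ j : κ', rsign (δ j) • B j.1 z) := fun ε δ z => by
      simp only [S, ContinuousLinearMap.comp_apply, _root_.sum_apply,
        _root_.smul_apply, Complex.coe_smul]
    have hS : ∀ ε δ z, ‖S ε δ z‖ ≤ K * ‖z‖ := fun ε δ z => by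
      rw [hSa]
      refine (norm_sum_rsign_smul_le bA iA ε _).trans ?_
      rw [hK, mul_assoc (2 * MA)]
      gcongr
      exact norm_sum_rsign_smul_le bB iB δ _
    have hSd : ∀ ε δ z, S ε δ z =
        ∑ i, ∑ j, (rsign (ε i) * rsign (δ j)) • A i.1 (B j.1 z) := fun ε δ z => by
      simp [hSa, Finset.smul_sum, mul_smul, ContinuousLinearMap.map_smul_of_tower]
    let c : κ → κ' → ℂ := fun i j => if (i.1, j.1) ∈ F then 1 else 0
    let w : (κ → Bool) → (κ' → Bool) → X := fun ε δ =>
      ∑ i, ∑ j, (rsign (ε i) * rsign (δ j)) • (c i j • A i.1 (B j.1 x))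
    -- the signs cancel when the signed sum is applied to `w`
    have hSw : ∀ ε δ, S ε δ (w ε δ) = ∑ k ∈ F, (A k.1).comp (B k.2) x := by
      intro ε δ
      have h1 : ∀ i j, S ε δ (A i.1 (B j.1 x)) =
          (rsign (ε i) * rsign (δ j)) • A i.1 (B j.1 x) := by
        intro i j
        have : ∑ l : κ', rsign (δ l) • B l.1 (A i.1 (B j.1 x)) =
            A i.1 (rsign (δ j) • B j.1 x) := by
          rw [← hB.1.sum_rsign_smul_apply iB δ j x]
          simp only [map_sum, hAB, ContinuousLinearMap.map_smul_of_tower]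
          rfl
        simp only [hSa, this]
        rw [hA.1.sum_rsign_smul_apply iA ε i, ContinuousLinearMap.map_smul_of_tower, smul_smul]
      have h2 : ∀ i j, (rsign (ε i) * rsign (δ j)) • c i j •
          (rsign (ε i) * rsign (δ j)) • A i.1 (B j.1 x) = c i j • A i.1 (B j.1 x) := by
        intro i j
        rw [smul_comm (c i j), smul_smul, mul_mul_mul_comm, rsign_mul_self, rsign_mul_self,
          one_mul, one_smul]
      simp only [w, map_sum, ContinuousLinearMap.map_smul_of_tower, h1, h2]
      have h3 := sum_rectangle (F := F)
        (f := fun k => if k ∈ F then (A k.1).comp (B k.2) x else 0) fun k hk => if_neg hk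
      rw [Finset.sum_congr rfl fun k hk => if_pos hk] at h3
      rw [← h3]
      simp only [c, ite_smul, one_smul, zero_smul, ContinuousLinearMap.comp_apply]
      rfl
    have hα := ha.fintype c (fun (i : κ) (j : κ') => A i.1 (B j.1 x)) (fun i j => by
      simp only [c]; split_ifs <;> simp)
    have hup : ∀ (ε : κ → Bool) (δ : κ' → Bool),
        ‖∑ i : κ, ∑ j : κ', (rsign (ε i) * rsign (δ j)) • A i.1 (B j.1 x)‖ ^ 2 ≤ (K * ‖x‖) ^ 2 := fun ε δ => by
      rw [← hSd]
      gcongr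
      exact hS ε δ x
    have hlow : ∀ ε δ, ‖∑ k ∈ F, (A k.1).comp (B k.2) x‖ ^ 2 ≤ K ^ 2 * ‖w ε δ‖ ^ 2 :=
      fun ε δ => by
      rw [← hSw ε δ, ← mul_pow]
      gcongr
      exact hS ε δ _
    have h1 := Finset.sum_le_sum fun (ε : κ → Bool) (_ : ε ∈ Finset.univ) =>
      Finset.sum_le_sum fun (δ : κ' → Bool) (_ : δ ∈ Finset.univ) => hlow ε δ
    have h2 := Finset.sum_le_sum fun (ε : κ → Bool) (_ : ε ∈ Finset.univ) =>
      Finset.sum_le_sum fun (δ : κ' → Bool) (_ : δ ∈ Finset.univ) => hup ε δ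
    have h3 := h1.trans (le_of_eq_of_le (by simp only [Finset.mul_sum]; rfl)
      (mul_le_mul_of_nonneg_left (hα.trans (mul_le_mul_of_nonneg_left h2 (sq_nonneg a)))
        (sq_nonneg K)))
    simp only [Finset.sum_const, Finset.card_univ, nsmul_eq_mul] at h3
    have hpos : (0 : ℝ) < Fintype.card (κ → Bool) * Fintype.card (κ' → Bool) := by
      exact_mod_cast Nat.mul_pos Fintype.card_pos Fintype.card_pos
    refine le_of_sq_le_sq (b := K ^ 2 * a * ‖x‖) ?_ (by positivity)
    refine le_of_mul_le_mul_left ?_ hpos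
    refine le_trans (le_of_eq ?_) (h3.trans (le_of_eq ?_)) <;> ring
  · have H := fun (z : X) => Metric.tendsto_atTop.1 (hA.2 z) (r / 2) (half_pos hr)
    obtain ⟨G, hG⟩ := Metric.tendsto_atTop.1 (hB.2 x) (r / 2) (half_pos hr)
    obtain ⟨F, hF⟩ := H (∑ j ∈ G, B j x)
    have hG := hG G le_rfl
    have hF := hF F le_rfl
    refine ⟨F ×ˢ G, x, ?_⟩
    have : ∑ k ∈ F ×ˢ G, (A k.1).comp (B k.2) x = ∑ i ∈ F, A i (∑ j ∈ G, B j x) := by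
      rw [Finset.sum_product]
      simp
    rw [this, ← dist_eq_norm]
    linarith [dist_triangle (∑ i ∈ F, A i (∑ j ∈ G, B j x)) (∑ j ∈ G, B j x) x]

end Unconditional

lemma sum_abs_le_of_subsums {τ : Type*} (S : Finset τ) (c : τ → ℝ) {B : ℝ}
    (h : ∀ T ⊆ S, |∑ t ∈ T, c t| ≤ B) : ∑ t ∈ S, |c t| ≤ 2 * B := by
  rw [← Finset.sum_filter_add_sum_filter_not S (fun t => 0 ≤ c t), two_mul]
  refine add_le_add ?_ ?_
  · refine le_trans (le_of_eq ?_) ((le_abs_self _).trans (h (S.filter fun t => 0 ≤ c t) (Finset.filter_subset _ _)))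
    exact Finset.sum_congr rfl fun t ht => abs_of_nonneg (Finset.mem_filter.1 ht).2
  · refine le_trans (le_of_eq ?_) ((neg_le_abs _).trans (h (S.filter fun t => ¬ 0 ≤ c t) (Finset.filter_subset _ _)))
    rw [← Finset.sum_neg_distrib]
    exact Finset.sum_congr rfl fun t ht =>
      abs_of_neg (not_le.1 (Finset.mem_filter.1 ht).2)

lemma sum_norm_le_of_subsums {τ : Type*} (S : Finset τ) (c : τ → ℂ) {B : ℝ}
    (h : ∀ T ⊆ S, ‖∑ t ∈ T, c t‖ ≤ B) : ∑ t ∈ S, ‖c t‖ ≤ 4 * B := by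
  have h1 := sum_abs_le_of_subsums S (fun t => (c t).re) (B := B) fun T hT => by
    rw [← Complex.re_sum]
    exact (Complex.abs_re_le_norm _).trans (h T hT)
  have h2 := sum_abs_le_of_subsums S (fun t => (c t).im) (B := B) fun T hT => by
    rw [← Complex.im_sum]
    exact (Complex.abs_im_le_norm _).trans (h T hT)
  have h3 := Finset.sum_le_sum fun t (_ : t ∈ S) => Complex.norm_le_abs_re_add_abs_im (c t)
  rw [Finset.sum_add_distrib] at h3
  linarith

/-- The bilinear form given by the Fourier matrix is small on sign vectors. -/
lemma norm_sum_stdAddChar_mul_le (N : ℕ) [NeZero N] (s t : ZMod N → ℝ)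
    (hs : ∀ i, s i * s i = 1) (ht : ∀ i, t i * t i = 1) :
    ‖∑ i, ∑ j, ((s i * t j : ℝ) : ℂ) * ZMod.stdAddChar (i * j)‖ ^ 2 ≤ (N : ℝ) ^ 3 := by
  have ht1 : ∀ j, |t j| = 1 := fun j => by
    have := ht j
    rw [← abs_mul_abs_self] at this
    nlinarith [abs_nonneg (t j)]
  let u : ZMod N → ℂ := fun j => ∑ i, (s i : ℂ) * ZMod.stdAddChar (i * j)
  have hu : ∑ j, ‖u j‖ ^ 2 = (N : ℝ) ^ 2 := by
    have : ∑ j, u j * (starRingEnd ℂ) (u j) = (N : ℂ) ^ 2 := by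
      have e : ∀ j, u j * (starRingEnd ℂ) (u j) = ∑ i, ∑ k,
          ((s i : ℂ) * s k) * ZMod.stdAddChar (j * (i - k)) := fun j => by
        simp only [u, map_sum, map_mul, Complex.conj_ofReal, Finset.sum_mul_sum]
        refine Finset.sum_congr rfl fun i _ => Finset.sum_congr rfl fun k _ => ?_
        rw [← AddChar.map_neg_eq_conj, mul_mul_mul_comm, ← AddChar.map_add_eq_mul]
        congr 2
        ring
      simp only [e]
      rw [Finset.sum_comm]
      have e' : ∀ i, ∑ j : ZMod N, ∑ k, ((s i : ℂ) * s k) * ZMod.stdAddChar (j * (i - k)) =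
          N := fun i => by
        rw [Finset.sum_comm]
        simp only [← Finset.mul_sum,
          AddChar.sum_mulShift _ (ZMod.isPrimitive_stdAddChar N), sub_eq_zero, ZMod.card]
        simp only [Nat.cast_ite, Nat.cast_zero, mul_ite, mul_zero, Finset.sum_ite_eq,
          Finset.mem_univ, if_true]
        rw [← Complex.ofReal_mul, hs]
        simp
      simp only [e']
      simp [sq]
    simp only [Complex.mul_conj'] at this
    exact_mod_cast this
  calc _ = ‖∑ j, (t j : ℂ) * u j‖ ^ 2 := by
        rw [Finset.sum_comm]
        congr 2
        refine Finset.sum_congr rfl fun j _ => ?_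
        rw [Finset.mul_sum]
        refine Finset.sum_congr rfl fun i _ => ?_
        push_cast
        ring
    _ ≤ (∑ j, ‖u j‖) ^ 2 := by
        gcongr
        refine (norm_sum_le _ _).trans (Finset.sum_le_sum fun j _ => ?_)
        rw [norm_mul, Complex.norm_real, Real.norm_eq_abs, ht1, one_mul]
    _ ≤ (Finset.univ : Finset (ZMod N)).card * ∑ j, ‖u j‖ ^ 2 := sq_sum_le_card_mul_sum_sq
    _ = _ := by
        rw [hu, Finset.card_univ, ZMod.card]
        ring

section Shrinking

variable {X : Type*} [NormedAddCommGroup X] [NormedSpace ℂ X] {ι : Type*}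

lemma dualOp_apply {Y : Type*} [NormedAddCommGroup Y] [NormedSpace ℂ Y]
    (T : X →L[ℂ] Y) (v : Y →L[ℂ] ℂ) (x : X) : dualOp T v x = v (T x) := rfl

lemma norm_sum_dualOp_le {Δ : ι → (X →L[ℂ] X)} {M : ℝ} (hM0 : 0 ≤ M)
    (hM : ∀ (F : Finset ι) (x : X), ‖∑ i ∈ F, Δ i x‖ ≤ M * ‖x‖) (F : Finset ι)
    (v : X →L[ℂ] ℂ) : ‖∑ i ∈ F, dualOp (Δ i) v‖ ≤ M * ‖v‖ := by
  refine ContinuousLinearMap.opNorm_le_bound _ (by positivity) fun x => ?_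
  simp only [_root_.sum_apply, dualOp_apply, ← map_sum]
  calc _ ≤ ‖v‖ * ‖∑ i ∈ F, Δ i x‖ := v.le_opNorm _
    _ ≤ ‖v‖ * (M * ‖x‖) := by gcongr; exact hM F x
    _ = _ := by ring

lemma IsPreDecomp.dualOp {Δ : ι → (X →L[ℂ] X)} (h : IsPreDecomp Δ) :
    IsPreDecomp (fun i => dualOp (Δ i)) := by
  refine ⟨fun i v => ?_, fun i j hij v => ?_⟩
  · ext x
    simp only [dualOp_apply, h.1]
  · ext x
    simp only [dualOp_apply, h.2 j i hij.symm, map_zero, zero_apply]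

/-- Disjoint blocks of the adjoint decomposition applied to a fixed functional behave like the
unit vector basis of `c₀`; under property `(α)` they cannot all be bounded below. -/
lemma card_mul_sq_le_of_blocks {Δ : ι → (X →L[ℂ] X)} (h : IsPreDecomp Δ) {a M r : ℝ}
    (ha : HasPisierAlphaWith (X →L[ℂ] ℂ) a) (hM0 : 0 < M)
    (hM : ∀ (F : Finset ι) (x : X), ‖∑ i ∈ F, Δ i x‖ ≤ M * ‖x‖) (v : X →L[ℂ] ℂ)
    (hr : 0 < r) {N : ℕ} [NeZero N]
    (H : (ZMod N → Bool) × (ZMod N → Bool) → Finset ι)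
    (hH : Pairwise (Function.onFun Disjoint H))
    (hlow : ∀ τ, r ≤ ‖∑ i ∈ H τ, dualOp (Δ i) v‖) :
    N * r ^ 2 ≤ a ^ 2 * (M * (4 * (M * ‖v‖))) ^ 2 := by
  classical
  let T := (ZMod N → Bool) × (ZMod N → Bool)
  let w : T → (X →L[ℂ] ℂ) := fun τ => ∑ i ∈ H τ, dualOp (Δ i) v
  have hup : ∀ (c : T → ℂ) (B : ℝ), (∀ τ, ‖c τ‖ ≤ B) →
      ‖∑ τ, c τ • w τ‖ ≤ B * (4 * (M * ‖v‖)) := by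
    intro c B hc
    have hB : 0 ≤ B := (norm_nonneg _).trans (hc (fun _ => true, fun _ => true))
    refine ContinuousLinearMap.opNorm_le_bound _ (by positivity) fun x => ?_
    have h1 : ∑ τ, ‖w τ x‖ ≤ 4 * (M * ‖v‖ * ‖x‖) := by
      refine sum_norm_le_of_subsums _ _ fun S _ => ?_
      rw [← _root_.sum_apply, ← Finset.sum_biUnion fun i _ j _ hij => hH hij]
      exact ContinuousLinearMap.le_of_opNorm_le _ (norm_sum_dualOp_le hM0.le hM _ v) x
    calc _ = ‖∑ τ, c τ * w τ x‖ := by simp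
      _ ≤ ∑ τ, ‖c τ‖ * ‖w τ x‖ := (norm_sum_le _ _).trans_eq (by simp)
      _ ≤ ∑ τ, B * ‖w τ x‖ := by gcongr; exact hc _
      _ ≤ B * (4 * (M * ‖v‖ * ‖x‖)) := by rw [← Finset.mul_sum]; gcongr
      _ = _ := by ring
  have hdn : ∀ (c : T → ℂ) (τ : T), ‖c τ‖ * r ≤ M * ‖∑ σ, c σ • w σ‖ := by
    intro c τ
    refine le_trans ?_ (norm_sum_dualOp_le hM0.le hM (H τ) _)
    have hd : ∀ i ∈ H τ, dualOp (Δ i) (∑ σ, c σ • w σ) = c τ • dualOp (Δ i) v := by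
      intro i hi
      simp only [map_sum, map_smul, w, h.dualOp.apply_apply]
      rw [Finset.sum_eq_single τ]
      · simp [hi]
      · intro σ _ hσ
        have : i ∉ H σ := fun hi' => Finset.disjoint_left.1 (hH hσ) hi' hi
        simp [this]
      · simp
    rw [Finset.sum_congr rfl hd, ← Finset.smul_sum, norm_smul]
    gcongr
    exact hlow τ
  let χ : ZMod N → ZMod N → ℂ := fun i j => ZMod.stdAddChar (i * j)
  have hχ : ∀ i j, ‖χ i j‖ = 1 := fun i j => AddChar.norm_apply _ _
  let x : ZMod N → ZMod N → (X →L[ℂ] ℂ) := fun i j =>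
    ∑ τ : T, (χ i j * (rsign (τ.1 i) * rsign (τ.2 j) : ℝ)) • w τ
  have hα := ha.fintype (fun i j => (starRingEnd ℂ) (χ i j)) x
    (fun i j => by simp [hχ])
  have hcoef : ∀ (b : ZMod N → ZMod N → ℂ) (ε δ : ZMod N → Bool),
      ∑ i, ∑ j, (rsign (ε i) * rsign (δ j)) • b i j • x i j =
      ∑ τ : T, (∑ i, ∑ j, ((rsign (ε i) * rsign (τ.1 i)) * (rsign (δ j) * rsign (τ.2 j)) : ℝ) *
        (b i j * χ i j)) • w τ := by
    intro b ε δ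
    have hw : ∀ (τ : T) (c : ZMod N → ZMod N → ℂ),
        (∑ i, ∑ j, c i j) • w τ = ∑ i, ∑ j, c i j • w τ := fun τ c => by
      refine (Finset.sum_smul (M := X →L[ℂ] ℂ)).trans (Finset.sum_congr rfl fun i _ => ?_)
      exact Finset.sum_smul (M := X →L[ℂ] ℂ)
    simp only [x, Finset.smul_sum, hw]
    rw [Finset.sum_comm (s := (Finset.univ : Finset T))]
    refine Finset.sum_congr rfl fun i _ => ?_
    rw [Finset.sum_comm (s := (Finset.univ : Finset T))]
    refine Finset.sum_congr rfl fun j _ => Finset.sum_congr rfl fun τ _ => ?_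
    rw [← Complex.coe_smul, smul_smul, smul_smul]
    congr 1
    push_cast
    ring
  have h1 : ∀ ε δ : ZMod N → Bool,
      ‖∑ i, ∑ j, (rsign (ε i) * rsign (δ j)) • x i j‖ ^ 2 ≤
        (N : ℝ) ^ 3 * (4 * (M * ‖v‖)) ^ 2 := by
    intro ε δ
    have := hcoef (fun _ _ => 1) ε δ
    simp only [one_smul, one_mul] at this
    rw [this]
    have h2 := hup _ (√((N : ℝ) ^ 3)) fun τ => Real.le_sqrt_of_sq_le
      (norm_sum_stdAddChar_mul_le N (fun i => rsign (ε i) * rsign (τ.1 i))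
        (fun j => rsign (δ j) * rsign (τ.2 j))
        (fun i => by rw [mul_mul_mul_comm, rsign_mul_self, rsign_mul_self, one_mul])
        (fun i => by rw [mul_mul_mul_comm, rsign_mul_self, rsign_mul_self, one_mul]))
    refine (pow_le_pow_left₀ (norm_nonneg _) h2 2).trans_eq ?_
    rw [mul_pow, Real.sq_sqrt (by positivity)]
  have h2 : ∀ ε δ : ZMod N → Bool, ((N : ℝ) ^ 2 * r) ^ 2 ≤ M ^ 2 *
      ‖∑ i, ∑ j, (rsign (ε i) * rsign (δ j)) • (starRingEnd ℂ) (χ i j) • x i j‖ ^ 2 := by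
    intro ε δ
    rw [hcoef, ← mul_pow]
    refine pow_le_pow_left₀ (by positivity) (le_of_eq_of_le ?_ (hdn _ (ε, δ))) 2
    congr 1
    simp only [rsign_mul_self, Complex.conj_mul', hχ]
    simp [sq]
  have h3 := Finset.sum_le_sum fun (ε : ZMod N → Bool) (_ : ε ∈ Finset.univ) =>
    Finset.sum_le_sum fun (δ : ZMod N → Bool) (_ : δ ∈ Finset.univ) => h1 ε δ
  have h4 := Finset.sum_le_sum fun (ε : ZMod N → Bool) (_ : ε ∈ Finset.univ) =>
    Finset.sum_le_sum fun (δ : ZMod N → Bool) (_ : δ ∈ Finset.univ) => h2 ε δ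
  have h5 := h4.trans (le_of_eq_of_le (by simp only [Finset.mul_sum])
    (mul_le_mul_of_nonneg_left (hα.trans (mul_le_mul_of_nonneg_left h3 (sq_nonneg a)))
      (sq_nonneg M)))
  simp only [Finset.sum_const, Finset.card_univ, nsmul_eq_mul] at h5
  have hN : (0 : ℝ) < N := by exact_mod_cast Nat.pos_of_ne_zero (NeZero.ne N)
  have hc : (0 : ℝ) < Fintype.card (ZMod N → Bool) := by exact_mod_cast Fintype.card_pos
  have hpos : (0 : ℝ) < Fintype.card (ZMod N → Bool) * Fintype.card (ZMod N → Bool) *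
    (N : ℝ) ^ 3 := by positivity
  refine le_of_mul_le_mul_left ?_ hpos
  refine le_trans (le_of_eq ?_) (h5.trans (le_of_eq ?_)) <;> ring

/-- If the dual has property `(α)`, an unconditional decomposition is shrinking. -/
lemma IsUncondDecomp.hasSum_dualOp [CompleteSpace X] {Δ : ι → (X →L[ℂ] X)}
    (h : IsUncondDecomp Δ) {a : ℝ} (ha : HasPisierAlphaWith (X →L[ℂ] ℂ) a) (v : X →L[ℂ] ℂ) :
    HasSum (fun i => dualOp (Δ i) v) v := by
  classical
  have hs : Summable (fun i => dualOp (Δ i) v) := by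
    by_contra hns
    rw [summable_iff_vanishing_norm] at hns
    push Not at hns
    obtain ⟨r, hr, hns⟩ := hns
    obtain ⟨H, hH, hd⟩ := exists_seq_of_forall_finset_exists'
      (fun t : Finset ι => r ≤ ‖∑ i ∈ t, dualOp (Δ i) v‖) Disjoint (fun s _ => by
        obtain ⟨t, ht, hrt⟩ := hns (s.sup id)
        exact ⟨t, hrt, fun u hu => (ht.mono_right (Finset.le_sup (f := id) hu)).symm⟩)
    obtain ⟨M, hM0, hM⟩ := h.exists_bound
    obtain ⟨N, hN⟩ := exists_nat_gt (a ^ 2 * (M * (4 * (M * ‖v‖))) ^ 2 / r ^ 2)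
    have hN0 : NeZero N := ⟨by
      rintro rfl
      exact absurd hN (not_lt.2 (by simp only [Nat.cast_zero]; positivity))⟩
    let e := Fintype.equivFin ((ZMod N → Bool) × (ZMod N → Bool))
    have := card_mul_sq_le_of_blocks h.1 ha hM0 hM v hr (N := N) (fun τ => H (e τ))
      (fun σ τ hστ => hd fun heq => hστ (e.injective (Fin.val_injective heq)))
      (fun τ => hH _)
    rw [div_lt_iff₀ (by positivity)] at hN
    linarith
  obtain ⟨u, hu⟩ := hs
  have : u = v := by
    ext x
    have h1 := hu.mapL (ContinuousLinearMap.apply ℂ ℂ x)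
    have h2 := (h.2 x).mapL v
    exact h1.unique h2
  rwa [this] at hu

end Shrinking

section DualUMinus

variable {X : Type*} [NormedAddCommGroup X] [NormedSpace ℂ X] {ι : Type*}

lemma sum_sign_comp_inl {κ κ' : Type*} [Fintype κ] [DecidableEq κ] [Fintype κ'] [DecidableEq κ']
    (Φ : (κ → Bool) → ℝ) :
    ∑ ε : κ ⊕ κ' → Bool, Φ (fun i => ε (Sum.inl i)) = 2 ^ Fintype.card κ' * ∑ ε, Φ ε := by
  rw [← (Equiv.sumArrowEquivProdArrow κ κ' Bool).symm.sum_comp, Fintype.sum_prod_type,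
    Finset.mul_sum]
  refine Finset.sum_congr rfl fun ε _ => ?_
  simp [Equiv.sumArrowEquivProdArrow]

/-- Randomized duality: a functional and a vector are paired through any sign pattern on a finite
set containing the support of the vector. -/
lemma norm_apply_sum_sq_le_of_dualOp [DecidableEq ι] {P : ι → (X →L[ℂ] X)} (hP : IsPreDecomp P)
    {D : ℝ} (hD : UPlusWith (fun i => dualOp (P i)) D) {F H : Finset ι} (hFH : Disjoint F H)
    (v : X →L[ℂ] ℂ) (x : X) :
    (2 : ℝ) ^ F.card * ‖v (∑ i ∈ F, P i x)‖ ^ 2 ≤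
      D ^ 2 * ‖∑ i ∈ F ∪ H, dualOp (P i) v‖ ^ 2 *
        ∑ ε : {i // i ∈ F} → Bool, ‖∑ i : {i // i ∈ F}, rsign (ε i) • P i.1 x‖ ^ 2 := by
  let κ := {i // i ∈ F} ⊕ {i // i ∈ H}
  let e : κ → ι := Sum.elim Subtype.val Subtype.val
  have he : Function.Injective e := by
    rintro (⟨i, hi⟩ | ⟨i, hi⟩) (⟨j, hj⟩ | ⟨j, hj⟩) hij
    · obtain rfl : i = j := hij
      rfl
    · exact absurd hj (by obtain rfl : i = j := hij; exact Finset.disjoint_left.1 hFH hi)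
    · exact absurd hi (by obtain rfl : i = j := hij; exact Finset.disjoint_left.1 hFH hj)
    · obtain rfl : i = j := hij
      rfl
  let b : ({i // i ∈ F} → Bool) → X := fun ε => ∑ i : {i // i ∈ F}, rsign (ε i) • P i.1 x
  let c : (κ → Bool) → (X →L[ℂ] ℂ) := fun ε => ∑ k, rsign (ε k) • dualOp (P (e k)) v
  have hpair : ∀ ε : κ → Bool, v (∑ i ∈ F, P i x) = c ε (b fun i => ε (Sum.inl i)) := by
    intro ε
    have h1 : ∀ k, dualOp (P (e k)) v (b fun i => ε (Sum.inl i)) =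
        ∑ i : {i // i ∈ F}, if k = Sum.inl i then rsign (ε k) • v (P i.1 x) else 0 := by
      intro k
      simp only [b, dualOp_apply, map_sum, ContinuousLinearMap.map_smul_of_tower]
      refine Finset.sum_congr rfl fun i _ => ?_
      rw [hP.apply_apply]
      by_cases hk : k = Sum.inl i
      · subst hk
        simp [e]
      · have : e k ≠ i.1 := fun heq => hk (he heq)
        simp [hk, this]
    simp only [c, _root_.sum_apply, _root_.smul_apply, h1]
    simp only [Finset.smul_sum]
    rw [Finset.sum_comm, map_sum, ← Finset.sum_coe_sort F]
    refine Finset.sum_congr rfl fun i _ => ?_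
    rw [Finset.sum_eq_single (Sum.inl i)]
    · rw [if_pos rfl, smul_smul, rsign_mul_self, one_smul]
    · intro k _ hk
      simp [hk]
    · simp
  have hle : (2 : ℝ) ^ Fintype.card κ * ‖v (∑ i ∈ F, P i x)‖ ≤
      ∑ ε : κ → Bool, ‖c ε‖ * ‖b fun i => ε (Sum.inl i)‖ := by
    calc _ = ∑ ε : κ → Bool, ‖v (∑ i ∈ F, P i x)‖ := by simp
      _ ≤ _ := Finset.sum_le_sum fun ε _ => by
        rw [hpair ε]
        exact (c ε).le_opNorm _
  have hcs := (pow_le_pow_left₀ (by positivity) hle 2).trans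
    (Finset.sum_mul_sq_le_sq_mul_sq _ _ _)
  have hc : ∑ ε, ‖c ε‖ ^ 2 ≤
      2 ^ Fintype.card κ * (D ^ 2 * ‖∑ i ∈ F ∪ H, dualOp (P i) v‖ ^ 2) := by
    refine (hD.of_injective he v).trans_eq ?_
    rw [Fintype.sum_sum_type, Finset.sum_union hFH, ← Finset.sum_coe_sort F,
      ← Finset.sum_coe_sort H]
    rfl
  rw [sum_sign_comp_inl fun ε => ‖b ε‖ ^ 2] at hcs
  have hcard : (2 : ℝ) ^ Fintype.card κ = 2 ^ F.card * 2 ^ H.card := by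
    simp [κ, pow_add]
  have hfin := hcs.trans (mul_le_mul_of_nonneg_right hc (by positivity))
  rw [Fintype.card_coe, hcard] at hfin
  refine le_of_mul_le_mul_left ?_
    (show (0 : ℝ) < 2 ^ F.card * 2 ^ H.card * 2 ^ H.card by positivity)
  refine le_trans (le_of_eq ?_) (hfin.trans (le_of_eq ?_)) <;> ring

/-- If the dual has property `(α)`, then `U⁺` for the adjoint family implies `U⁻`. -/
lemma IsUncondDecomp.uMinusWith_of_dualOp [CompleteSpace X] [DecidableEq ι]
    {P : ι → (X →L[ℂ] X)} (hP : IsUncondDecomp P) {a D : ℝ}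
    (ha : HasPisierAlphaWith (X →L[ℂ] ℂ) a) (hD : UPlusWith (fun i => dualOp (P i)) D) :
    UMinusWith P D := by
  intro F x
  obtain ⟨v, hv, hvx⟩ := exists_dual_vector'' ℂ (∑ i ∈ F, P i x)
  set S := ∑ ε : {i // i ∈ F} → Bool, ‖∑ i : {i // i ∈ F}, rsign (ε i) • P i.1 x‖ ^ 2
  have hlim : Tendsto (fun G : Finset ι => D ^ 2 * ‖∑ i ∈ G, dualOp (P i) v‖ ^ 2 * S) atTop
      (nhds (D ^ 2 * ‖v‖ ^ 2 * S)) :=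
    Tendsto.mul_const _ (Tendsto.const_mul _ ((hP.hasSum_dualOp ha v).norm.pow 2))
  have hle : (2 : ℝ) ^ F.card * ‖∑ i ∈ F, P i x‖ ^ 2 ≤ D ^ 2 * ‖v‖ ^ 2 * S := by
    refine ge_of_tendsto hlim ((eventually_ge_atTop F).mono fun G hG => ?_)
    have := norm_apply_sum_sq_le_of_dualOp hP.1 hD (F := F) (H := G \ F) Finset.disjoint_sdiff v x
    rw [Finset.union_sdiff_of_subset hG, hvx] at this
    rwa [RCLike.norm_ofReal, abs_norm] at this
  refine hle.trans ?_
  have h1 : ‖v‖ ^ 2 ≤ 1 := pow_le_one₀ (norm_nonneg _) hv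
  calc _ = D ^ 2 * S * ‖v‖ ^ 2 := by ring
    _ ≤ D ^ 2 * S * 1 := by gcongr
    _ = _ := mul_one _

end DualUMinus

section ProdProj

variable {X : Type*} [NormedAddCommGroup X] [NormedSpace ℂ X]

lemma prodProj_succ {n : ℕ} {ι : Fin (n + 1) → Type*} (Δ : ∀ j, ι j → (X →L[ℂ] X))
    (i : ∀ j, ι j) : prodProj Δ i =
      (Δ 0 (i 0)).comp (prodProj (fun j => Δ j.succ) fun j => i j.succ) := by
  simp [prodProj, List.finRange_succ, List.foldr_map]

lemma prodProj_zero {ι : Fin 0 → Type*} (Δ : ∀ j, ι j → (X →L[ℂ] X)) (i : ∀ j, ι j) :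
    prodProj Δ i = ContinuousLinearMap.id ℂ X := by
  simp [prodProj]

lemma apply_prodProj_comm {n : ℕ} {ι : Fin n → Type*} {Δ : ∀ j, ι j → (X →L[ℂ] X)}
    {i : ∀ j, ι j} {T : X →L[ℂ] X} (h : ∀ j x, T (Δ j (i j) x) = Δ j (i j) (T x)) (x : X) :
    T (prodProj Δ i x) = prodProj Δ i (T x) := by
  induction n with
  | zero => simp [prodProj_zero]
  | succ n ih =>
    simp only [prodProj_succ, ContinuousLinearMap.comp_apply]
    rw [h, ih fun j x => h j.succ x]

lemma dualOp_prodProj {n : ℕ} {ι : Fin n → Type*} {Δ : ∀ j, ι j → (X →L[ℂ] X)}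
    (hcomm : ∀ j j', j ≠ j' → ∀ a b (x : X), Δ j a (Δ j' b x) = Δ j' b (Δ j a x))
    (i : ∀ j, ι j) : dualOp (prodProj Δ i) = prodProj (fun j b => dualOp (Δ j b)) i := by
  induction n with
  | zero =>
    ext v x
    simp [prodProj_zero, dualOp_apply]
  | succ n ih =>
    rw [prodProj_succ (fun j b => dualOp (Δ j b)),
      ← ih (fun j j' hjj => hcomm j.succ j'.succ (by simpa using hjj)) fun j => i j.succ]
    ext v x
    simp only [prodProj_succ, ContinuousLinearMap.comp_apply, dualOp_apply]
    rw [apply_prodProj_comm fun j x => hcomm 0 j.succ (Fin.succ_ne_zero j).symm _ _ x]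

lemma isPreDecomp_prodProj {n : ℕ} {ι : Fin (n + 1) → Type*} {Δ : ∀ j, ι j → (X →L[ℂ] X)}
    (hdec : ∀ j, IsPreDecomp (Δ j))
    (hcomm : ∀ j j', j ≠ j' → ∀ a b (x : X), Δ j a (Δ j' b x) = Δ j' b (Δ j a x)) :
    IsPreDecomp (prodProj Δ) := by
  induction n with
  | zero =>
    have := (hdec 0).comp_injective (Equiv.piUnique (α := Fin 1) ι).injective
    refine (congrArg IsPreDecomp (funext fun i => ?_)).mp this
    rw [prodProj_succ, prodProj_zero, ContinuousLinearMap.comp_id]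
    rfl
  | succ n ih =>
    have := ((hdec 0).prod (ih (fun j => hdec j.succ) fun j j' hjj =>
      hcomm j.succ j'.succ (by simpa using hjj)) fun a b x => apply_prodProj_comm
        (fun j x => hcomm 0 j.succ (Fin.succ_ne_zero j).symm _ _ x) x).comp_injective
      (Fin.consEquiv ι).symm.injective
    exact (congrArg IsPreDecomp (funext fun i => (prodProj_succ Δ i).symm)).mp this

lemma uPlusWith_prodProj {n : ℕ} {ι : Fin (n + 1) → Type*} [∀ j, DecidableEq (ι j)]
    {Δ : ∀ j, ι j → (X →L[ℂ] X)} {a : ℝ} (ha : HasPisierAlphaWith X a)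
    (hdec : ∀ j, IsPreDecomp (Δ j))
    (hcomm : ∀ j j', j ≠ j' → ∀ a b (x : X), Δ j a (Δ j' b x) = Δ j' b (Δ j a x))
    {C : Fin (n + 1) → ℝ} (hC : ∀ j, UPlusWith (Δ j) (C j)) :
    UPlusWith (prodProj Δ) (a ^ n * ∏ j, C j) := by
  induction n with
  | zero =>
    have := (hC 0).comp_injective (Equiv.piUnique (α := Fin 1) ι).injective
    have e : (fun i : ∀ j, ι j => Δ 0 (i 0)) = prodProj Δ := funext fun i => by
      rw [prodProj_succ, prodProj_zero, ContinuousLinearMap.comp_id]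
    rw [← e]
    simpa using this
  | succ n ih =>
    have hcomm' : ∀ j j' : Fin (n + 1), j ≠ j' → ∀ a b (x : X),
        Δ j.succ a (Δ j'.succ b x) = Δ j'.succ b (Δ j.succ a x) :=
      fun j j' hjj => hcomm j.succ j'.succ (by simpa using hjj)
    have := ((hC 0).prod ha (hdec 0) (isPreDecomp_prodProj (fun j => hdec j.succ) hcomm')
      (fun a b x => apply_prodProj_comm
        (fun j x => hcomm 0 j.succ (Fin.succ_ne_zero j).symm _ _ x) x)
      (ih (fun j => hdec j.succ) hcomm' fun j => hC j.succ)).comp_injective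
      (Fin.consEquiv ι).symm.injective
    have e : (fun i : ∀ j, ι j => (Δ 0 (i 0)).comp (prodProj (fun j => Δ j.succ)
        fun j => i j.succ)) = prodProj Δ := funext fun i => (prodProj_succ Δ i).symm
    rw [← e]
    have hc : a ^ (n + 1) * ∏ j, C j = a * (C 0 * (a ^ n * ∏ j : Fin (n + 1), C j.succ)) := by
      rw [Fin.prod_univ_succ]
      ring
    rw [hc]
    exact this

lemma isUncondDecomp_prodProj [CompleteSpace X] {n : ℕ} {ι : Fin (n + 1) → Type*}
    {Δ : ∀ j, ι j → (X →L[ℂ] X)} {a : ℝ} (ha : HasPisierAlphaWith X a)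
    (hdec : ∀ j, IsUncondDecomp (Δ j))
    (hcomm : ∀ j j', j ≠ j' → ∀ a b (x : X), Δ j a (Δ j' b x) = Δ j' b (Δ j a x)) :
    IsUncondDecomp (prodProj Δ) := by
  induction n with
  | zero =>
    have := (hdec 0).comp_equiv (Equiv.piUnique (α := Fin 1) ι)
    refine (congrArg IsUncondDecomp (funext fun i => ?_)).mp this
    rw [prodProj_succ, prodProj_zero, ContinuousLinearMap.comp_id]
    rfl
  | succ n ih =>
    have := (IsUncondDecomp.prod ha (hdec 0) (ih (fun j => hdec j.succ) fun j j' hjj =>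
      hcomm j.succ j'.succ (by simpa using hjj)) fun a b x => apply_prodProj_comm
        (fun j x => hcomm 0 j.succ (Fin.succ_ne_zero j).symm _ _ x) x).comp_equiv
      (Fin.consEquiv ι).symm
    exact (congrArg IsUncondDecomp (funext fun i => (prodProj_succ Δ i).symm)).mp this

end ProdProj

/-- Products of commuting unconditional decompositions under
Pisier's property `(α)`: if both `X` and `X^*` have property `(α)` (with constants
`aX`, `aXd`) and `Δ^1, …, Δ^n` are commuting unconditional decompositions of `X`
(with `U⁺`-constants `Cp j` and dual `U⁺`-constants `Cpd j`), then the product family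
`Δ_i = Δ^1_{i_1} ⋯ Δ^n_{i_n}` is an unconditional decomposition of `X` with
`C⁺_Δ ≤ aX^{n-1} ∏ Cp j` and `C⁻_Δ ≤ C⁺_{Δ^*} ≤ aXd^{n-1} ∏ Cpd j`. -/
theorem product_unconditional_decomposition
    {E : Type*} [NormedAddCommGroup E] [NormedSpace ℂ E] [CompleteSpace E]
    (aX aXd : ℝ)
    (haX : HasPisierAlphaWith E aX)
    (haXd : HasPisierAlphaWith (E →L[ℂ] ℂ) aXd)
    (n : ℕ) (hn : 1 ≤ n) {ι : Fin n → Type*} [∀ j, DecidableEq (ι j)]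
    (Δ : ∀ j, ι j → (E →L[ℂ] E))
    (hdec : ∀ j, IsUncondDecomp (Δ j))
    (hcomm : ∀ j j', j ≠ j' → ∀ a b (x : E), Δ j a (Δ j' b x) = Δ j' b (Δ j a x))
    (Cp Cpd : Fin n → ℝ)
    (hCp : ∀ j, UPlusWith (Δ j) (Cp j))
    (hCpd : ∀ j, UPlusWith (fun i => dualOp (Δ j i)) (Cpd j)) :
    IsUncondDecomp (fun i : (∀ j, ι j) => prodProj Δ i) ∧
    UPlusWith (fun i : (∀ j, ι j) => prodProj Δ i) (aX ^ (n - 1) * ∏ j, Cp j) ∧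
    (∀ D : ℝ, UPlusWith (fun i : (∀ j, ι j) => dualOp (prodProj Δ i)) D →
      UMinusWith (fun i : (∀ j, ι j) => prodProj Δ i) D) ∧
    UPlusWith (fun i : (∀ j, ι j) => dualOp (prodProj Δ i)) (aXd ^ (n - 1) * ∏ j, Cpd j) ∧
    UMinusWith (fun i : (∀ j, ι j) => prodProj Δ i) (aXd ^ (n - 1) * ∏ j, Cpd j) := by
  obtain ⟨m, rfl⟩ := Nat.exists_eq_add_of_le' hn
  have hU := isUncondDecomp_prodProj haX hdec hcomm
  have hmin : ∀ D : ℝ, UPlusWith (fun i : (∀ j, ι j) => dualOp (prodProj Δ i)) D →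
      UMinusWith (fun i : (∀ j, ι j) => prodProj Δ i) D :=
    fun D hD => hU.uMinusWith_of_dualOp haXd hD
  have hplus : UPlusWith (fun i : (∀ j, ι j) => dualOp (prodProj Δ i))
      (aXd ^ (m + 1 - 1) * ∏ j, Cpd j) := by
    simp only [dualOp_prodProj hcomm]
    refine uPlusWith_prodProj haXd (fun j => (hdec j).1.dualOp) (fun j j' hjj a b v => ?_) hCpd
    ext x
    simp only [dualOp_apply, hcomm j j' hjj]
  exact ⟨hU, uPlusWith_prodProj haX (fun j => (hdec j).1) hcomm hCp, hmin, hplus, hmin _ hplus⟩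

end
end
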